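/- arXiv:2312.06469 — 3 statements merged into one kernel-verified Lean document; each statement's English description precedes it below -/
import Mathlib

section
/- (Lower bound / Γ-liminf inequality) Let (w^L,u^L) ∈ A_L^in × A_L^out, L>0, be a sequence converging to μ ∈ M_∞ in the sense that (μ^L(u^L), μ^L_{,x}(u^L)) converges weakly-* to (μ, μ_{,x}). Then liminf_{L→∞} F_L(w^L,u^L) ≥ F_∞(μ). -/
open MeasureTheory Set Filter Topology
open scoped ENNReal

noncomputable section

/-- The open strip `(-1,1) × ℝ`. -/
def Strip : Set (ℝ × ℝ) := Ioo (-1 : ℝ) 1 ×ˢ (univ : Set ℝ)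

/-- Smooth test functions compactly supported in a set `A ⊆ ℝ²`. -/
def IsTest2D (A : Set (ℝ × ℝ)) (φ : ℝ × ℝ → ℝ) : Prop :=
  ContDiff ℝ (⊤ : ℕ∞) φ ∧ HasCompactSupport φ ∧ tsupport φ ⊆ A

/-- Smooth test functions compactly supported in the strip. -/
def IsTest (φ : ℝ × ℝ → ℝ) : Prop := IsTest2D Strip φ

/-- 1D smooth test functions compactly supported in `I ⊆ ℝ`. -/
def IsTest1D (I : Set ℝ) (φ : ℝ → ℝ) : Prop :=
  ContDiff ℝ (⊤ : ℕ∞) φ ∧ HasCompactSupport φ ∧ tsupport φ ⊆ I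

/-- Integral of `f` against a signed measure. -/
def sInt (s : SignedMeasure (ℝ × ℝ)) (f : ℝ × ℝ → ℝ) : ℝ :=
  (∫ p, f p ∂s.toJordanDecomposition.posPart) - ∫ p, f p ∂s.toJordanDecomposition.negPart

/-- Integral of `f` against a signed measure restricted to `A`. -/
def sIntOn (s : SignedMeasure (ℝ × ℝ)) (A : Set (ℝ × ℝ)) (f : ℝ × ℝ → ℝ) : ℝ :=
  (∫ p in A, f p ∂s.toJordanDecomposition.posPart) -
    ∫ p in A, f p ∂s.toJordanDecomposition.negPart

/-- The partial derivative in the `x`-direction of a function on `ℝ²`. -/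
def dX (φ : ℝ × ℝ → ℝ) (p : ℝ × ℝ) : ℝ := fderiv ℝ φ p (1, 0)

/-- A pair `(μ, μ_{,x})` consisting of a positive measure together with (a candidate for)
its distributional `x`-derivative. -/
structure MeasPair where
  mu : Measure (ℝ × ℝ)
  mux : SignedMeasure (ℝ × ℝ)

/-- The class `M_∞`: bounded positive measures on `(-1,1) × ℝ` vanishing on `(-1,0] × ℝ`,
whose distributional `x`-derivative is a bounded measure, absolutely continuous w.r.t. `μ`,
and satisfying the constraint `∫ φ(x) dμ = ∫ 2xφ(x) dx`. -/
def MemMInfty (P : MeasPair) : Prop :=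
  IsFiniteMeasure P.mu ∧
  P.mu Stripᶜ = 0 ∧
  P.mu ((Ioc (-1 : ℝ) 0) ×ˢ (univ : Set ℝ)) = 0 ∧
  (∀ φ : ℝ × ℝ → ℝ, IsTest φ → sInt P.mux φ = - ∫ p, dX φ p ∂P.mu) ∧
  P.mux.totalVariation ≪ P.mu ∧
  (∀ φ : ℝ → ℝ, IsTest1D (Ioo (0 : ℝ) 1) φ →
    ∫ p in Ioo (0 : ℝ) 1 ×ˢ (univ : Set ℝ), φ p.1 ∂P.mu = ∫ x in Ioo (0 : ℝ) 1, 2 * x * φ x)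

/-- The limit functional `F_∞`. -/
def Finfty (P : MeasPair) : ℝ≥0∞ :=
  ∫⁻ p in Ioo (0 : ℝ) 1 ×ˢ (univ : Set ℝ),
    ENNReal.ofReal (p.2 ^ 2 + 1 / (4 * p.2 ^ 2) * (P.mux.rnDeriv P.mu p) ^ 2) ∂P.mu

/-- The class `M_∞^λ` of measures on `(0,λ) × ℝ`. -/
def MemMInftyLam (lam : ℝ) (P : MeasPair) : Prop :=
  IsFiniteMeasure P.mu ∧
  P.mu ((Ioo (0 : ℝ) lam ×ˢ (univ : Set ℝ))ᶜ) = 0 ∧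
  (∀ φ : ℝ × ℝ → ℝ, IsTest2D (Ioo (0 : ℝ) lam ×ˢ (univ : Set ℝ)) φ →
      sInt P.mux φ = - ∫ p, dX φ p ∂P.mu) ∧
  P.mux.totalVariation ≪ P.mu ∧
  (∀ φ : ℝ → ℝ, IsTest1D (Ioo (0 : ℝ) lam) φ →
    ∫ x in Ioo (0 : ℝ) lam, 2 * x * φ x =
      ∫ p in Ioo (0 : ℝ) lam ×ˢ (univ : Set ℝ), φ p.1 ∂P.mu)

/-- The functional `F_∞^λ`. -/
def FinftyLam (lam : ℝ) (P : MeasPair) : ℝ≥0∞ :=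
  ∫⁻ p in Ioo (0 : ℝ) lam ×ˢ (univ : Set ℝ),
    ENNReal.ofReal (p.2 ^ 2 + 1 / (4 * p.2 ^ 2) * (P.mux.rnDeriv P.mu p) ^ 2) ∂P.mu

/-- Weak partial derivative in direction `v` on the strip `(-1,1) × ℝ`. -/
def HasWeakPartial (v : ℝ × ℝ) (u g : ℝ × ℝ → ℝ) : Prop :=
  ∀ φ : ℝ × ℝ → ℝ, IsTest φ →
    ∫ p in Strip, u p * (fderiv ℝ φ p v) = - ∫ p in Strip, g p * φ p

/-- Weak derivative on an interval `I ⊆ ℝ`. -/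
def HasWeakDerivOn1D (I : Set ℝ) (g g' : ℝ → ℝ) : Prop :=
  ∀ φ : ℝ → ℝ, IsTest1D I φ →
    ∫ x in I, g x * deriv φ x = - ∫ x in I, g' x * φ x

/-- One periodicity cell `(-1,1) × (-L,L]`. -/
def Cell (L : ℝ) : Set (ℝ × ℝ) := Ioo (-1 : ℝ) 1 ×ˢ Ioc (-L) L

/-- An out-of-plane displacement together with its (weak) partial derivatives. -/
structure OutData where
  u : ℝ × ℝ → ℝ
  ux : ℝ × ℝ → ℝ
  uy : ℝ × ℝ → ℝ
  uxx : ℝ × ℝ → ℝ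
  uxy : ℝ × ℝ → ℝ
  uyy : ℝ × ℝ → ℝ

/-- Membership in `A_L^out`: `2L`-periodicity in `y` together with `W^{2,2}` regularity:
the bundled functions are the weak partial derivatives and all of them are square
integrable on a periodicity cell. -/
def MemALout (L : ℝ) (d : OutData) : Prop :=
  (∀ x y : ℝ, d.u (x, y + 2 * L) = d.u (x, y)) ∧
  HasWeakPartial (1, 0) d.u d.ux ∧ HasWeakPartial (0, 1) d.u d.uy ∧
  HasWeakPartial (1, 0) d.ux d.uxx ∧ HasWeakPartial (0, 1) d.ux d.uxy ∧
  HasWeakPartial (0, 1) d.uy d.uyy ∧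
  MemLp d.u 2 (volume.restrict (Cell L)) ∧ MemLp d.ux 2 (volume.restrict (Cell L)) ∧
  MemLp d.uy 2 (volume.restrict (Cell L)) ∧ MemLp d.uxx 2 (volume.restrict (Cell L)) ∧
  MemLp d.uxy 2 (volume.restrict (Cell L)) ∧ MemLp d.uyy 2 (volume.restrict (Cell L))

/-- An in-plane displacement together with its (weak) partial derivatives. -/
structure InData where
  w1 : ℝ × ℝ → ℝ
  w2 : ℝ × ℝ → ℝ
  w1x : ℝ × ℝ → ℝ
  w1y : ℝ × ℝ → ℝ
  w2x : ℝ × ℝ → ℝ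
  w2y : ℝ × ℝ → ℝ

/-- Membership in `A_L^in`. -/
def MemALin (L : ℝ) (d : InData) : Prop :=
  (∀ x y : ℝ, d.w1 (x, y + 2 * L) = d.w1 (x, y)) ∧
  (∀ x y : ℝ, d.w2 (x, y + 2 * L) = d.w2 (x, y)) ∧
  HasWeakPartial (1, 0) d.w1 d.w1x ∧ HasWeakPartial (0, 1) d.w1 d.w1y ∧
  HasWeakPartial (1, 0) d.w2 d.w2x ∧ HasWeakPartial (0, 1) d.w2 d.w2y ∧
  MemLp d.w1 2 (volume.restrict (Cell L)) ∧ MemLp d.w2 2 (volume.restrict (Cell L)) ∧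
  MemLp d.w1x 2 (volume.restrict (Cell L)) ∧ MemLp d.w1y 2 (volume.restrict (Cell L)) ∧
  MemLp d.w2x 2 (volume.restrict (Cell L)) ∧ MemLp d.w2y 2 (volume.restrict (Cell L))

/-- The rescaled elastic energy `E_L` (an average over `y ∈ (-L,L)` of an integral
over `x ∈ (-1,1)`). -/
def energyEL (L : ℝ) (w : InData) (d : OutData) : ℝ :=
  (2 * L)⁻¹ * ∫ p in Cell L,
    (((w.w1x p + (d.ux p) ^ 2 / (2 * L ^ 2) - 1) ^ 2 - 1)
      + (w.w2y p + (d.uy p) ^ 2 / 2 - p.1) ^ 2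
      + (L ^ 2)⁻¹ * (L ^ 2 * w.w1y p + w.w2x p + d.ux p * d.uy p) ^ 2
      + (L ^ 2)⁻¹ * ((d.ux p) ^ 2 + (d.uyy p) ^ 2)
      + (L ^ 4)⁻¹ * (2 * (d.uxy p) ^ 2 + (L ^ 2)⁻¹ * (d.uxx p) ^ 2))

/-- The rescaled excess energy `F_L = L² (E_L + 5/3)`. -/
def FL (L : ℝ) (w : InData) (d : OutData) : ℝ := L ^ 2 * (energyEL L w d + 5 / 3)

/-- The frequency `k = π m / L`. -/
def Freq (L : ℝ) (m : ℤ) : ℝ := Real.pi * (m : ℝ) / L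

/-- The Fourier coefficient `a_k(x)` of `u(x,·)`. -/
def fourierCoef (L : ℝ) (u : ℝ × ℝ → ℝ) (k x : ℝ) : ℝ :=
  if 0 < k then Real.sqrt 2 * ((2 * L)⁻¹ * ∫ y in Ioc (-L) L, u (x, y) * Real.sin (k * y))
  else if k < 0 then Real.sqrt 2 * ((2 * L)⁻¹ * ∫ y in Ioc (-L) L, u (x, y) * Real.cos (k * y))
  else (2 * L)⁻¹ * ∫ y in Ioc (-L) L, u (x, y)

/-- The weight `a(x,k) = k² a_k(x)²` at frequency `k = πm/L`. -/
def aWeight (L : ℝ) (u : ℝ × ℝ → ℝ) (m : ℤ) (x : ℝ) : ℝ :=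
  (Freq L m) ^ 2 * (fourierCoef L u (Freq L m) x) ^ 2

/-- Pairing of the measure `μ^L(u) = Σ_k k² a_k(x)² (L¹⌐(-1,1)) × δ_k` with `φ`. -/
def muLpair (L : ℝ) (u : ℝ × ℝ → ℝ) (φ : ℝ × ℝ → ℝ) : ℝ :=
  ∑' m : ℤ, ∫ x in Ioo (-1 : ℝ) 1, aWeight L u m x * φ (x, Freq L m)

/-- Pairing of the distributional `x`-derivative `μ^L_{,x}(u)` with `φ`. -/
def muLxpair (L : ℝ) (u : ℝ × ℝ → ℝ) (φ : ℝ × ℝ → ℝ) : ℝ :=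
  ∑' m : ℤ, ∫ x in Ioo (-1 : ℝ) 1, deriv (aWeight L u m) x * φ (x, Freq L m)

/-- Convergence of `(w, u)` (indexed over a filter) to `μ ∈ M_∞` in the sense of
weak-* convergence of `(μ^L(u), μ^L_{,x}(u))` to `(μ, μ_{,x})`. -/
def ConvTo {ι : Type*} (l : Filter ι) (Lf : ι → ℝ) (uf : ι → (ℝ × ℝ → ℝ)) (P : MeasPair) :
    Prop :=
  ∀ φ : ℝ × ℝ → ℝ, Continuous φ → HasCompactSupport φ →
    Tendsto (fun i => muLpair (Lf i) (uf i) φ) l (𝓝 (∫ p, φ p ∂P.mu)) ∧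
    Tendsto (fun i => muLxpair (Lf i) (uf i) φ) l (𝓝 (sInt P.mux φ))

/-- Disintegration of `μ` in the `x`-variable on `I × ℝ` as `(ν_x, g(x))`. -/
def IsDisintegrationX (I : Set ℝ) (μ : Measure (ℝ × ℝ)) (ν : ℝ → Measure ℝ) (g : ℝ → ℝ) :
    Prop :=
  (∀ s : Set ℝ, MeasurableSet s → Measurable fun x => ν x s) ∧
  (∀ x ∈ I, ν x (univ : Set ℝ) = 1) ∧
  IntegrableOn g I ∧
  ∀ f : ℝ × ℝ → ℝ, Integrable f μ →
    ∫ p in I ×ˢ (univ : Set ℝ), f p ∂μ = ∫ x in I, (∫ k, f (x, k) ∂(ν x)) * g x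

/-- Disintegration of `μ` in the `k`-variable as `(λ, (g_k))`. -/
def IsDisintegrationK (I : Set ℝ) (μ : Measure (ℝ × ℝ)) (lamm : Measure ℝ)
    (g : ℝ → ℝ → ℝ) : Prop :=
  Measurable (Function.uncurry g) ∧
  (∀ᵐ k ∂lamm, ∫ x in I, g k x = 1) ∧
  ∀ f : ℝ × ℝ → ℝ, Integrable f μ →
    ∫ p in I ×ˢ (univ : Set ℝ), f p ∂μ = ∫ k, (∫ x in I, f (x, k) * g k x) ∂lamm

/-- The total variation measure of the pair `τ = (μ, μ_{,x})` (when `μ_{,x} ≪ μ`):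
`d|τ| = √(1 + (dμ_{,x}/dμ)²) dμ`. -/
def tvPair (P : MeasPair) : Measure (ℝ × ℝ) :=
  P.mu.withDensity fun p => ENNReal.ofReal (Real.sqrt (1 + (P.mux.rnDeriv P.mu p) ^ 2))

/-- `A^L(x) = ½ ⨍ (u_{,y}(x,·))² dy`. -/
def ALfun (L : ℝ) (d : OutData) (x : ℝ) : ℝ :=
  (1 / 2) * ((2 * L)⁻¹ * ∫ y in Ioc (-L) L, (d.uy (x, y)) ^ 2)

/-- `f^L(x) = √(x / A^L(x))`. -/
def fLfun (L : ℝ) (d : OutData) (x : ℝ) : ℝ := Real.sqrt (x / ALfun L d x)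

/-- Average in `y` over a period. -/
def avgY (L : ℝ) (F : ℝ × ℝ → ℝ) (x : ℝ) : ℝ := (2 * L)⁻¹ * ∫ y in Ioc (-L) L, F (x, y)

/-- `⨍_{-L}^L ∫_{-1}^1 F dx dy`. -/
def avgCell (L : ℝ) (F : ℝ × ℝ → ℝ) : ℝ := (2 * L)⁻¹ * ∫ p in Cell L, F p

/-- Scaling of a pair `(μ, μ_{,x})` by `α > 0`. -/
def smulPair (α : ℝ) (P : MeasPair) : MeasPair :=
  ⟨ENNReal.ofReal α • P.mu, α • P.mux⟩

/-- Convex combination `t μ₁ + (1-t) μ₂` of pairs. -/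
def combPair (t : ℝ) (P Q : MeasPair) : MeasPair :=
  ⟨ENNReal.ofReal t • P.mu + ENNReal.ofReal (1 - t) • Q.mu, t • P.mux + (1 - t) • Q.mux⟩

/-! ### The real trigonometric basis -/

/-- The real trigonometric basis function at frequency `Freq L m`. -/
def trig (L : ℝ) (m : ℤ) (y : ℝ) : ℝ :=
  (if m = 0 then 1 else Real.sqrt 2) *
    Real.cos (Freq L m * y - if 0 < m then Real.pi / 2 else 0)

/-- The coefficient of `f(x, ·)` along `trig L m`. -/
def trigCoef (L : ℝ) (m : ℤ) (f : ℝ × ℝ → ℝ) (x : ℝ) : ℝ :=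
  (2 * L)⁻¹ * ∫ y in Ioc (-L) L, f (x, y) * trig L m y

lemma Freq_pos_iff {L : ℝ} (hL : 0 < L) (m : ℤ) : 0 < Freq L m ↔ 0 < m := by
  unfold Freq
  rw [div_pos_iff_of_pos_right hL, mul_pos_iff_of_pos_left Real.pi_pos]
  exact_mod_cast Iff.rfl

lemma Freq_neg_iff {L : ℝ} (hL : 0 < L) (m : ℤ) : Freq L m < 0 ↔ m < 0 := by
  unfold Freq
  rw [div_neg_iff]
  simp [hL, not_lt.2 hL.le, mul_neg_iff, Real.pi_pos, not_lt.2 Real.pi_pos.le]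

lemma fourierCoef_eq_trigCoef {L : ℝ} (hL : 0 < L) (m : ℤ) (u : ℝ × ℝ → ℝ) (x : ℝ) :
    fourierCoef L u (Freq L m) x = trigCoef L m u x := by
  unfold fourierCoef trigCoef trig
  simp only [Freq_pos_iff hL, Freq_neg_iff hL]
  rcases lt_trichotomy m 0 with h | h | h
  · have h1 : ¬ 0 < m := by lia
    have h2 : m ≠ 0 := by lia
    simp only [h1, h, h2, if_true, if_false, sub_zero]
    rw [mul_left_comm, ← integral_const_mul]
    congr 2; ext y; ring
  · subst h
    simp [Freq]
  · have h2 : m ≠ 0 := by lia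
    simp only [h, h2, if_true, if_false, Real.cos_sub_pi_div_two]
    rw [mul_left_comm, ← integral_const_mul]
    congr 2; ext y; ring

lemma contDiff_trig (L : ℝ) (m : ℤ) : ContDiff ℝ (⊤ : ℕ∞) (trig L m) := by
  unfold trig
  fun_prop

lemma continuous_trig (L : ℝ) (m : ℤ) : Continuous (trig L m) := (contDiff_trig L m).continuous

lemma trig_periodic {L : ℝ} (hL : 0 < L) (m : ℤ) (y : ℝ) :
    trig L m (y + 2 * L) = trig L m y := by
  unfold trig
  congr 1
  rw [← Real.cos_add_int_mul_two_pi (Freq L m * y - if 0 < m then Real.pi / 2 else 0) m]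
  congr 1
  unfold Freq
  field_simp
  ring

lemma abs_trig_le (L : ℝ) (m : ℤ) (y : ℝ) : |trig L m y| ≤ 2 := by
  unfold trig
  rw [abs_mul]
  have h1 : |if m = 0 then (1 : ℝ) else Real.sqrt 2| ≤ 2 := by
    split_ifs
    · norm_num
    · rw [abs_of_nonneg (Real.sqrt_nonneg _)]
      exact Real.sqrt_le_iff.2 (by norm_num)
  have h2 := Real.abs_cos_le_one (Freq L m * y - if 0 < m then Real.pi / 2 else 0)
  nlinarith [abs_nonneg (if m = 0 then (1 : ℝ) else Real.sqrt 2), abs_nonneg (Real.cos (Freq L m * y - if 0 < m then Real.pi / 2 else 0))]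

lemma trig_zero (L y : ℝ) : trig L 0 y = 1 := by simp [trig, Freq]

lemma iteratedDeriv_two_trig (L : ℝ) (m : ℤ) :
    iteratedDeriv 2 (trig L m) = fun y => -(Freq L m ^ 2) * trig L m y := by
  have h1 : deriv (trig L m) = fun y => -((if m = 0 then 1 else Real.sqrt 2) * Freq L m *
      Real.sin (Freq L m * y - if 0 < m then Real.pi / 2 else 0)) := by
    ext y
    have : HasDerivAt (trig L m) ((if m = 0 then 1 else Real.sqrt 2) *
        (-Real.sin (Freq L m * y - if 0 < m then Real.pi / 2 else 0) * (Freq L m * 1))) y :=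
      ((((hasDerivAt_id y).const_mul (Freq L m)).sub_const _).cos).const_mul _
    rw [this.deriv]; ring
  rw [iteratedDeriv_succ, iteratedDeriv_one, h1]
  ext y
  have : HasDerivAt (fun y => -((if m = 0 then 1 else Real.sqrt 2) * Freq L m *
      Real.sin (Freq L m * y - if 0 < m then Real.pi / 2 else 0)))
      (-((if m = 0 then 1 else Real.sqrt 2) * Freq L m *
      (Real.cos (Freq L m * y - if 0 < m then Real.pi / 2 else 0) * (Freq L m * 1)))) y :=
    (((((hasDerivAt_id y).const_mul (Freq L m)).sub_const _).sin).const_mul _).neg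
  rw [this.deriv, trig]; ring

lemma integral_cos_Freq {L : ℝ} (hL : 0 < L) (n : ℤ) (α : ℝ) :
    ∫ y in (-L)..L, Real.cos (Freq L n * y - α) = if n = 0 then 2 * L * Real.cos α else 0 := by
  split_ifs with h
  · subst h
    simp only [Freq, Int.cast_zero, mul_zero, zero_div, zero_mul, zero_sub, Real.cos_neg,
      intervalIntegral.integral_const, smul_eq_mul]
    ring
  · have hF : Freq L n ≠ 0 := by
      unfold Freq; positivity
    have hd : ∀ y ∈ uIcc (-L) L, HasDerivAt (fun y => (Freq L n)⁻¹ * Real.sin (Freq L n * y - α))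
        (Real.cos (Freq L n * y - α)) y := by
      intro y _
      have := ((((hasDerivAt_id y).const_mul (Freq L n)).sub_const α).sin).const_mul (Freq L n)⁻¹
      convert! this using 1
      simp; field_simp
    rw [intervalIntegral.integral_eq_sub_of_hasDerivAt hd
      (Continuous.intervalIntegrable (by fun_prop) _ _)]
    have : Freq L n * L - α = (Freq L n * (-L) - α) + n * (2 * Real.pi) := by
      unfold Freq; field_simp; ring
    rw [this, Real.sin_add_int_mul_two_pi, sub_self]

lemma integral_trig_mul_trig {L : ℝ} (hL : 0 < L) (m n : ℤ) :
    ∫ y in Ioc (-L) L, trig L m y * trig L n y = if m = n then 2 * L else 0 := by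
  rw [← intervalIntegral.integral_of_le (by linarith)]
  set c : ℤ → ℝ := fun m => if m = 0 then 1 else Real.sqrt 2 with hc
  set θ : ℤ → ℝ := fun m => if 0 < m then Real.pi / 2 else 0 with hθ
  have key : ∀ y, trig L m y * trig L n y = c m * c n / 2 *
      (Real.cos (Freq L (m - n) * y - (θ m - θ n)) +
        Real.cos (Freq L (m + n) * y - (θ m + θ n))) := by
    intro y
    have e1 : Freq L (m - n) * y - (θ m - θ n) =
        (Freq L m * y - θ m) - (Freq L n * y - θ n) := by
      unfold Freq; push_cast; ring
    have e2 : Freq L (m + n) * y - (θ m + θ n) =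
        (Freq L m * y - θ m) + (Freq L n * y - θ n) := by
      unfold Freq; push_cast; ring
    rw [e1, e2, Real.cos_add, Real.cos_sub]
    simp only [trig, hc, hθ]
    ring
  simp_rw [key]
  rw [intervalIntegral.integral_const_mul, intervalIntegral.integral_add
    (Continuous.intervalIntegrable (by fun_prop) _ _)
    (Continuous.intervalIntegrable (by fun_prop) _ _), integral_cos_Freq hL, integral_cos_Freq hL]
  have s2 : Real.sqrt 2 * Real.sqrt 2 = 2 := Real.mul_self_sqrt (by norm_num)
  by_cases h : m = n
  · subst h
    by_cases h0 : m = 0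
    · subst h0; simp [hc, hθ]; ring
    · have : m + m ≠ 0 := by lia
      simp [hc, this, h0]
  · have h1 : m - n ≠ 0 := by lia
    simp only [h1, h, if_false, zero_add]
    split_ifs with h2
    · have : θ m + θ n = Real.pi / 2 := by
        simp only [hθ]
        rcases lt_trichotomy m 0 with h3 | h3 | h3
        · have : ¬ 0 < m := by lia
          have h4 : 0 < n := by lia
          simp [this, h4]
        · lia
        · have : ¬ 0 < n := by lia
          simp [this, h3]
      simp [this]
    · simp

/-- Bessel's inequality for the trigonometric basis. -/
lemma sum_trig_sq_le {L : ℝ} (hL : 0 < L) (S : Finset ℤ) {f : ℝ → ℝ}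
    (hf : MemLp f 2 (volume.restrict (Ioc (-L) L))) :
    ∑ m ∈ S, ((2 * L)⁻¹ * ∫ y in Ioc (-L) L, f y * trig L m y) ^ 2 ≤
      (2 * L)⁻¹ * ∫ y in Ioc (-L) L, f y ^ 2 := by
  set μ := volume.restrict (Ioc (-L) L) with hμ
  set c : ℤ → ℝ := fun m => (2 * L)⁻¹ * ∫ y, f y * trig L m y ∂μ with hc
  have ht : ∀ m, MemLp (trig L m) 2 μ := fun m =>
    MemLp.of_bound (continuous_trig L m).aestronglyMeasurable 2
      (Eventually.of_forall fun y => abs_trig_le L m y)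
  have hft : ∀ m, Integrable (fun y => f y * trig L m y) μ := fun m => hf.integrable_mul (ht m)
  have htt : ∀ m n, Integrable (fun y => trig L m y * trig L n y) μ :=
    fun m n => (ht m).integrable_mul (ht n)
  have hff : Integrable (fun y => f y ^ 2) μ := hf.integrable_sq
  have e : ∀ m, ∫ y, f y * trig L m y ∂μ = 2 * L * c m := by
    intro m; simp only [hc]; field_simp
  have h0 : 0 ≤ ∫ y, (f y ^ 2 - ∑ m ∈ S, 2 * c m * (f y * trig L m y) +
      ∑ m ∈ S, ∑ n ∈ S, c m * c n * (trig L m y * trig L n y)) ∂μ := by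
    apply integral_nonneg
    intro y
    have : f y ^ 2 - ∑ m ∈ S, 2 * c m * (f y * trig L m y) +
      ∑ m ∈ S, ∑ n ∈ S, c m * c n * (trig L m y * trig L n y) =
        (f y - ∑ m ∈ S, c m * trig L m y) ^ 2 := by
      rw [sub_sq, sq (∑ m ∈ S, c m * trig L m y), Finset.sum_mul_sum, Finset.mul_sum]
      congr 1
      · congr 1
        exact Finset.sum_congr rfl fun m _ => by ring
      · exact Finset.sum_congr rfl fun m _ => Finset.sum_congr rfl fun n _ => by ring
    simp only [Pi.zero_apply]
    rw [this]; positivity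
  have i1 : Integrable (fun y => ∑ m ∈ S, 2 * c m * (f y * trig L m y)) μ :=
    integrable_finsetSum _ fun m _ => (hft m).const_mul _
  have i2 : Integrable (fun y => ∑ m ∈ S, ∑ n ∈ S, c m * c n * (trig L m y * trig L n y)) μ :=
    integrable_finsetSum _ fun m _ => integrable_finsetSum _ fun n _ => (htt m n).const_mul _
  have i0 : Integrable (fun y => f y ^ 2 - ∑ m ∈ S, 2 * c m * (f y * trig L m y)) μ := hff.sub i1
  rw [integral_add i0 i2, integral_sub hff i1,
    integral_finsetSum _ fun m _ => (hft m).const_mul _,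
    integral_finsetSum _ fun m _ => integrable_finsetSum _ fun n _ => (htt m n).const_mul _] at h0
  simp_rw [integral_finsetSum S fun n _ => (htt _ n).const_mul _, integral_const_mul, e, hμ,
    integral_trig_mul_trig hL, mul_ite, mul_zero] at h0
  simp only [Finset.sum_ite_eq] at h0
  have h1 : ∑ m ∈ S, 2 * c m * (2 * L * c m) = 4 * L * ∑ m ∈ S, c m ^ 2 := by
    rw [Finset.mul_sum]; exact Finset.sum_congr rfl fun m _ => by ring
  have h2 : (∑ m ∈ S, if m ∈ S then c m * c m * (2 * L) else 0) = 2 * L * ∑ m ∈ S, c m ^ 2 := by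
    rw [Finset.mul_sum]; exact Finset.sum_congr rfl fun m hm => by rw [if_pos hm]; ring
  rw [h1, h2] at h0
  rw [inv_mul_eq_div, le_div_iff₀ (by positivity)]
  linarith

/-! ### Trigonometric coefficients on a periodicity cell -/

lemma volume_restrict_Cell (L : ℝ) : (volume : Measure (ℝ × ℝ)).restrict (Cell L) =
    ((volume : Measure ℝ).restrict (Ioo (-1) 1)).prod (volume.restrict (Ioc (-L) L)) := by
  rw [Cell, Measure.volume_eq_prod, Measure.prod_restrict]

lemma measurableSet_Cell (L : ℝ) : MeasurableSet (Cell L) :=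
  measurableSet_Ioo.prod measurableSet_Ioc

lemma measurableSet_Strip : MeasurableSet Strip :=
  measurableSet_Ioo.prod MeasurableSet.univ

lemma Cell_subset_Strip (L : ℝ) : Cell L ⊆ Strip := prod_mono_right (subset_univ _)

instance isFiniteMeasure_restrict_Cell (L : ℝ) :
    IsFiniteMeasure ((volume : Measure (ℝ × ℝ)).restrict (Cell L)) := by
  rw [volume_restrict_Cell]; infer_instance

lemma ae_memLp_slice {L : ℝ} {f : ℝ × ℝ → ℝ} (hf : MemLp f 2 (volume.restrict (Cell L))) :
    ∀ᵐ x ∂(volume : Measure ℝ).restrict (Ioo (-1) 1),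
      MemLp (fun y => f (x, y)) 2 (volume.restrict (Ioc (-L) L)) := by
  have h1 := hf.aestronglyMeasurable
  have h2 := hf.integrable_sq
  rw [volume_restrict_Cell] at h1 h2
  filter_upwards [h1.prodMk_left, h2.prod_right_ae] with x hx1 hx2
  exact (memLp_two_iff_integrable_sq hx1).2 hx2

lemma aestronglyMeasurable_trigCoef {L : ℝ} (m : ℤ) {f : ℝ × ℝ → ℝ}
    (hf : MemLp f 2 (volume.restrict (Cell L))) :
    AEStronglyMeasurable (trigCoef L m f) ((volume : Measure ℝ).restrict (Ioo (-1) 1)) := by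
  have h1 := hf.aestronglyMeasurable
  rw [volume_restrict_Cell] at h1
  have h2 : AEStronglyMeasurable (fun p : ℝ × ℝ => f p * trig L m p.2)
      (((volume : Measure ℝ).restrict (Ioo (-1) 1)).prod (volume.restrict (Ioc (-L) L))) :=
    h1.mul ((continuous_trig L m).comp continuous_snd).aestronglyMeasurable
  exact h2.integral_prod_right'.const_mul _

lemma integrable_avg_sq {L : ℝ} {f : ℝ × ℝ → ℝ}
    (hf : MemLp f 2 (volume.restrict (Cell L))) :
    Integrable (fun x => (2 * L)⁻¹ * ∫ y in Ioc (-L) L, f (x, y) ^ 2)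
      ((volume : Measure ℝ).restrict (Ioo (-1) 1)) := by
  have h2 := hf.integrable_sq
  rw [volume_restrict_Cell] at h2
  exact h2.integral_prod_left.const_mul _

lemma memLp_trigCoef {L : ℝ} (hL : 0 < L) (m : ℤ) {f : ℝ × ℝ → ℝ}
    (hf : MemLp f 2 (volume.restrict (Cell L))) :
    MemLp (trigCoef L m f) 2 ((volume : Measure ℝ).restrict (Ioo (-1) 1)) := by
  have h1 := aestronglyMeasurable_trigCoef m hf
  rw [memLp_two_iff_integrable_sq h1]
  refine (integrable_avg_sq hf).mono' (h1.pow 2) ?_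
  filter_upwards [ae_memLp_slice hf] with x hx
  have := sum_trig_sq_le hL {m} hx
  rw [Finset.sum_singleton] at this
  rw [Real.norm_of_nonneg (sq_nonneg _)]
  exact this

lemma sum_integral_trigCoef_sq_le {L : ℝ} (hL : 0 < L) (S : Finset ℤ) {f : ℝ × ℝ → ℝ}
    (hf : MemLp f 2 (volume.restrict (Cell L))) :
    ∑ m ∈ S, ∫ x in Ioo (-1 : ℝ) 1, trigCoef L m f x ^ 2 ≤
      (2 * L)⁻¹ * ∫ p in Cell L, f p ^ 2 := by
  have h2 := hf.integrable_sq
  rw [volume_restrict_Cell] at h2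
  rw [volume_restrict_Cell, integral_prod _ h2, ← integral_const_mul,
    ← integral_finsetSum _ fun m _ => (memLp_trigCoef hL m hf).integrable_sq]
  refine integral_mono_ae
    (integrable_finsetSum _ fun m _ => (memLp_trigCoef hL m hf).integrable_sq)
    (integrable_avg_sq hf) ?_
  filter_upwards [ae_memLp_slice hf] with x hx
  exact sum_trig_sq_le hL S hx

lemma MeasureTheory.MemLp.integrable_mul_bounded {α : Type*} [MeasurableSpace α] {μ : Measure α}
    [IsFiniteMeasure μ] {f g : α → ℝ} (hf : MemLp f 2 μ) (hg : AEStronglyMeasurable g μ) {C : ℝ}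
    (hC : ∀ p, |g p| ≤ C) : Integrable (fun p => f p * g p) μ :=
  have hg2 : MemLp g 2 μ := MemLp.of_bound hg C (Eventually.of_forall hC)
  hf.integrable_mul hg2

lemma integral_trigCoef_mul {L : ℝ} (m : ℤ) {f : ℝ × ℝ → ℝ}
    (hf : MemLp f 2 (volume.restrict (Cell L))) {η : ℝ → ℝ} (hη : Continuous η) {C : ℝ}
    (hC : ∀ x, |η x| ≤ C) :
    ∫ x in Ioo (-1 : ℝ) 1, trigCoef L m f x * η x =
      (2 * L)⁻¹ * ∫ p in Cell L, f p * (η p.1 * trig L m p.2) := by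
  have hc : Continuous fun p : ℝ × ℝ => η p.1 * trig L m p.2 :=
    (hη.comp continuous_fst).mul ((continuous_trig L m).comp continuous_snd)
  have h2 := hf.integrable_mul_bounded hc.aestronglyMeasurable (C := C * 2) (by
    intro p
    rw [abs_mul]
    exact mul_le_mul (hC _) (abs_trig_le _ _ _) (abs_nonneg _) ((abs_nonneg _).trans (hC 0)))
  rw [volume_restrict_Cell] at h2
  rw [volume_restrict_Cell, integral_prod _ h2, ← integral_const_mul]
  congr 1
  ext x
  rw [trigCoef, mul_assoc, ← integral_mul_const]
  congr 2
  ext y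
  ring

/-! ### Product test functions and cutoffs -/

lemma isTest_mul {η h : ℝ → ℝ} (hη : IsTest1D (Ioo (-1) 1) η) (hh : ContDiff ℝ (⊤ : ℕ∞) h)
    (hc : HasCompactSupport h) : IsTest fun p => η p.1 * h p.2 := by
  obtain ⟨h1, h2, h3⟩ := hη
  have hsub : (Function.support fun p : ℝ × ℝ => η p.1 * h p.2) ⊆ tsupport η ×ˢ tsupport h := by
    intro p hp
    have hp' : η p.1 * h p.2 ≠ 0 := hp
    exact ⟨subset_tsupport _ (left_ne_zero_of_mul hp'), subset_tsupport _ (right_ne_zero_of_mul hp')⟩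
  have hcpt : IsCompact (tsupport η ×ˢ tsupport h) := IsCompact.prod h2 hc
  have hts : (tsupport fun p : ℝ × ℝ => η p.1 * h p.2) ⊆ tsupport η ×ˢ tsupport h :=
    closure_minimal hsub hcpt.isClosed
  refine ⟨(h1.comp contDiff_fst).mul (hh.comp contDiff_snd), ?_, ?_⟩
  · exact hcpt.of_isClosed_subset (isClosed_tsupport _) hts
  · exact fun p hp => ⟨h3 (hts hp).1, mem_univ _⟩

lemma fderiv_mul_prod {η h : ℝ → ℝ} (hη : ContDiff ℝ (⊤ : ℕ∞) η)
    (hh : ContDiff ℝ (⊤ : ℕ∞) h) (p : ℝ × ℝ) (v : ℝ × ℝ) :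
    fderiv ℝ (fun p : ℝ × ℝ => η p.1 * h p.2) p v =
      v.1 * (deriv η p.1 * h p.2) + v.2 * (η p.1 * deriv h p.2) := by
  have d1 : HasDerivAt η (deriv η p.1) p.1 :=
    (hη.differentiable (by simp) p.1).hasDerivAt
  have d2 : HasDerivAt h (deriv h p.2) p.2 :=
    (hh.differentiable (by simp) p.2).hasDerivAt
  have f1 := d1.hasFDerivAt.comp p (hasFDerivAt_fst (𝕜 := ℝ) (p := p))
  have f2 := d2.hasFDerivAt.comp p (hasFDerivAt_snd (𝕜 := ℝ) (p := p))
  have f3 := f1.mul f2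
  have : (fun p : ℝ × ℝ => η p.1 * h p.2) = (η ∘ Prod.fst) * (h ∘ Prod.snd) := rfl
  rw [this, f3.fderiv]
  simp
  ring

lemma fderiv_mul_prod_fst {η h : ℝ → ℝ} (hη : ContDiff ℝ (⊤ : ℕ∞) η)
    (hh : ContDiff ℝ (⊤ : ℕ∞) h) (p : ℝ × ℝ) :
    fderiv ℝ (fun p : ℝ × ℝ => η p.1 * h p.2) p (1, 0) = deriv η p.1 * h p.2 := by
  rw [fderiv_mul_prod hη hh]; simp

lemma fderiv_mul_prod_snd {η h : ℝ → ℝ} (hη : ContDiff ℝ (⊤ : ℕ∞) η)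
    (hh : ContDiff ℝ (⊤ : ℕ∞) h) (p : ℝ × ℝ) :
    fderiv ℝ (fun p : ℝ × ℝ => η p.1 * h p.2) p (0, 1) = η p.1 * deriv h p.2 := by
  rw [fderiv_mul_prod hη hh]; simp

lemma IsTest2D.fderiv_apply {A : Set (ℝ × ℝ)} {φ : ℝ × ℝ → ℝ} (hφ : IsTest2D A φ) (v : ℝ × ℝ) :
    IsTest2D A fun p => fderiv ℝ φ p v := by
  obtain ⟨h1, h2, h3⟩ := hφ
  refine ⟨?_, h2.fderiv_apply ℝ v, (tsupport_fderiv_apply_subset ℝ v).trans h3⟩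
  exact (h1.fderiv_right (m := (⊤ : ℕ∞)) (by simp)).clm_apply contDiff_const

lemma IsTest1D.deriv {I : Set ℝ} {φ : ℝ → ℝ} (hφ : IsTest1D I φ) : IsTest1D I (deriv φ) := by
  obtain ⟨h1, h2, h3⟩ := hφ
  exact ⟨(contDiff_infty_iff_deriv.1 h1).2, h2.deriv, (tsupport_deriv_subset).trans h3⟩

lemma IsTest1D.exists_bound {I : Set ℝ} {φ : ℝ → ℝ} (hφ : IsTest1D I φ) :
    ∃ C, ∀ x, |φ x| ≤ C :=
  hφ.2.1.exists_bound_of_continuous hφ.1.continuous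

/-- Smooth plateau function: vanishes outside `[α + 1/n, β - 1/n]`, and equals `1` on
`[α + 2/n, β - 2/n]`. -/
def plateau (α β n : ℝ) (y : ℝ) : ℝ :=
  Real.smoothTransition (n * (y - α) - 1) * Real.smoothTransition (n * (β - y) - 1)

lemma contDiff_plateau (α β n : ℝ) : ContDiff ℝ (⊤ : ℕ∞) (plateau α β n) := by
  unfold plateau
  exact (Real.smoothTransition.contDiff.comp (by fun_prop)).mul
    (Real.smoothTransition.contDiff.comp (by fun_prop))

lemma plateau_nonneg (α β n y : ℝ) : 0 ≤ plateau α β n y :=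
  mul_nonneg (Real.smoothTransition.nonneg _) (Real.smoothTransition.nonneg _)

lemma plateau_le_one (α β n y : ℝ) : plateau α β n y ≤ 1 :=
  mul_le_one₀ (Real.smoothTransition.le_one _) (Real.smoothTransition.nonneg _)
    (Real.smoothTransition.le_one _)

lemma tsupport_plateau {α β n : ℝ} (hn : 0 < n) :
    tsupport (plateau α β n) ⊆ Icc (α + n⁻¹) (β - n⁻¹) := by
  refine closure_minimal (fun y hy => ?_) isClosed_Icc
  have hy' : plateau α β n y ≠ 0 := hy
  have h1 := left_ne_zero_of_mul hy'
  have h2 := right_ne_zero_of_mul hy'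
  have h1' : ¬ (n * (y - α) - 1 ≤ 0) := fun h => h1 (Real.smoothTransition.zero_of_nonpos h)
  have h2' : ¬ (n * (β - y) - 1 ≤ 0) := fun h => h2 (Real.smoothTransition.zero_of_nonpos h)
  have e : n * n⁻¹ = 1 := mul_inv_cancel₀ hn.ne'
  constructor
  · by_contra h; apply h1'; push Not at h; nlinarith
  · by_contra h; apply h2'; push Not at h; nlinarith

lemma isTest1D_plateau {α β n : ℝ} (hn : 0 < n) : IsTest1D (Ioo α β) (plateau α β n) := by
  have h := tsupport_plateau (α := α) (β := β) hn
  have hi : 0 < n⁻¹ := inv_pos.2 hn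
  exact ⟨contDiff_plateau _ _ _, isCompact_Icc.of_isClosed_subset (isClosed_tsupport _) h,
    fun y hy => ⟨by linarith [(h hy).1], by linarith [(h hy).2]⟩⟩

lemma plateau_eq_one {α β n y : ℝ} (h1 : 2 ≤ n * (y - α)) (h2 : 2 ≤ n * (β - y)) :
    plateau α β n y = 1 := by
  unfold plateau
  rw [Real.smoothTransition.one_of_one_le (by linarith),
    Real.smoothTransition.one_of_one_le (by linarith), one_mul]

lemma eventually_plateau_eq_one {α β y : ℝ} (h1 : α < y) (h2 : y < β) :
    ∀ᶠ n : ℕ in atTop, plateau α β (n + 1 : ℝ) y = 1 := by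
  have t1 : Tendsto (fun n : ℕ => ((n : ℝ) + 1) * (y - α)) atTop atTop :=
    (tendsto_atTop_add_const_right _ _ tendsto_natCast_atTop_atTop).atTop_mul_const (by linarith)
  have t2 : Tendsto (fun n : ℕ => ((n : ℝ) + 1) * (β - y)) atTop atTop :=
    (tendsto_atTop_add_const_right _ _ tendsto_natCast_atTop_atTop).atTop_mul_const (by linarith)
  filter_upwards [t1.eventually_ge_atTop 2, t2.eventually_ge_atTop 2] with n hn1 hn2
  exact plateau_eq_one hn1 hn2

/-! ### Testing against functions that do not vanish at the ends of the period -/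

lemma Cell_ae_lt (L : ℝ) : ∀ᵐ p ∂(volume : Measure (ℝ × ℝ)).restrict (Cell L),
    p.1 ∈ Ioo (-1 : ℝ) 1 ∧ -L < p.2 ∧ p.2 < L := by
  have h0 : (volume : Measure (ℝ × ℝ)) (univ ×ˢ {L}) = 0 := by
    rw [Measure.volume_eq_prod, Measure.prod_prod]; simp
  have h1 : ∀ᵐ p ∂(volume : Measure (ℝ × ℝ)).restrict (Cell L), p ∉ (univ : Set ℝ) ×ˢ ({L} : Set ℝ) :=
    ae_restrict_of_ae (measure_eq_zero_iff_ae_notMem.1 h0)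
  filter_upwards [h1, ae_restrict_mem (measurableSet_Cell L)] with p hp1 hp2
  refine ⟨hp2.1, hp2.2.1, lt_of_le_of_ne hp2.2.2 fun h => hp1 ⟨mem_univ _, h⟩⟩

/-- Interior cutoffs of the cell converge to `1` under the integral. -/
lemma tendsto_integral_mul_plateau {L : ℝ} {f : ℝ × ℝ → ℝ}
    (hf : MemLp f 2 (volume.restrict (Cell L))) {g : ℝ × ℝ → ℝ} (hg : Continuous g) {C : ℝ}
    (hC : ∀ p ∈ Cell L, |g p| ≤ C) :
    Tendsto (fun n : ℕ => ∫ p in Cell L, f p * (g p * plateau (-L) L (n + 1 : ℝ) p.2)) atTop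
      (𝓝 (∫ p in Cell L, f p * g p)) := by
  have hpl : ∀ n : ℕ, Continuous fun p : ℝ × ℝ => plateau (-L) L (n + 1 : ℝ) p.2 :=
    fun n => (contDiff_plateau _ _ _).continuous.comp continuous_snd
  have hfi : Integrable f (volume.restrict (Cell L)) := hf.integrable one_le_two
  refine tendsto_integral_of_dominated_convergence (fun p => ‖f p‖ * C) ?_ ?_ ?_ ?_
  · intro n
    exact hf.aestronglyMeasurable.mul (hg.mul (hpl n)).aestronglyMeasurable
  · exact hfi.norm.mul_const C
  · intro n
    filter_upwards [ae_restrict_mem (measurableSet_Cell L)] with p hp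
    rw [norm_mul, norm_mul]
    refine mul_le_mul_of_nonneg_left ?_ (norm_nonneg _)
    rw [Real.norm_of_nonneg (plateau_nonneg _ _ _ _)]
    exact (mul_le_of_le_one_right (norm_nonneg _) (plateau_le_one _ _ _ _)).trans (hC p hp)
  · filter_upwards [Cell_ae_lt L] with p hp
    refine tendsto_const_nhds.congr' ?_
    filter_upwards [eventually_plateau_eq_one hp.2.1 hp.2.2] with n hn
    rw [hn, mul_one]

lemma setIntegral_Strip_eq_Cell {L : ℝ} {f : ℝ × ℝ → ℝ} (h : ∀ p, p.2 ∉ Ioc (-L) L → f p = 0) :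
    ∫ p in Strip, f p = ∫ p in Cell L, f p := by
  refine setIntegral_eq_of_subset_of_forall_sdiff_eq_zero measurableSet_Strip (Cell_subset_Strip L) ?_
  intro p hp
  exact h p fun h' => hp.2 ⟨hp.1.1, h'⟩

lemma plateau_eq_zero {α β n y : ℝ} (hn : 0 < n) (h : y ∉ Ioc α β) : plateau α β n y = 0 := by
  by_contra h'
  have h1 := (isTest1D_plateau (α := α) (β := β) hn).2.2 (subset_tsupport _ h')
  exact h ⟨h1.1, h1.2.le⟩

/-- The weak `x`-derivative may be tested against `η(x) e(y)` on the cell. -/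
lemma weak_x_cell {L : ℝ} {u ux : ℝ × ℝ → ℝ} (hw : HasWeakPartial (1, 0) u ux)
    (hu : MemLp u 2 (volume.restrict (Cell L))) (hux : MemLp ux 2 (volume.restrict (Cell L)))
    {η e : ℝ → ℝ} (hη : IsTest1D (Ioo (-1) 1) η) (he : ContDiff ℝ (⊤ : ℕ∞) e) {C : ℝ}
    (hC : ∀ y, |e y| ≤ C) :
    ∫ p in Cell L, u p * (deriv η p.1 * e p.2) = -∫ p in Cell L, ux p * (η p.1 * e p.2) := by
  obtain ⟨C1, hC1⟩ := hη.exists_bound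
  obtain ⟨C2, hC2⟩ := hη.deriv.exists_bound
  have bd : ∀ {h : ℝ → ℝ} {D : ℝ}, (∀ x, |h x| ≤ D) → ∀ p ∈ Cell L, |h p.1 * e p.2| ≤ D * C := by
    intro h D hD p _
    rw [abs_mul]
    exact mul_le_mul (hD _) (hC _) (abs_nonneg _) ((abs_nonneg _).trans (hD 0))
  have t1 := tendsto_integral_mul_plateau hu (g := fun p => deriv η p.1 * e p.2)
    ((hη.deriv.1.continuous.comp continuous_fst).mul (he.continuous.comp continuous_snd)) (bd hC2)
  have t2 := tendsto_integral_mul_plateau hux (g := fun p => η p.1 * e p.2)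
    ((hη.1.continuous.comp continuous_fst).mul (he.continuous.comp continuous_snd)) (bd hC1)
  refine tendsto_nhds_unique t1 (t2.neg.congr fun n => ?_)
  have hn : (0 : ℝ) < n + 1 := by positivity
  have hp := isTest1D_plateau (α := -L) (β := L) hn
  have hh : ContDiff ℝ (⊤ : ℕ∞) fun y => e y * plateau (-L) L (n + 1 : ℝ) y := he.mul hp.1
  have key := hw _ (isTest_mul hη hh hp.2.1.mul_left)
  simp only [fderiv_mul_prod_fst hη.1 hh] at key
  rw [setIntegral_Strip_eq_Cell (L := L) (by intro p hp; simp [plateau_eq_zero hn hp]),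
    setIntegral_Strip_eq_Cell (L := L) (by intro p hp; simp [plateau_eq_zero hn hp])] at key
  simp only [← mul_assoc] at key ⊢
  exact key.symm

/-! ### Periodic functions and weak `y`-derivatives -/

lemma measurePreserving_shift (c : ℝ) :
    MeasurePreserving (fun p : ℝ × ℝ => (p.1, p.2 + c)) volume volume := by
  have h := measurePreserving_add_right (volume : Measure (ℝ × ℝ)) ((0 : ℝ), c)
  convert h using 2 with p
  ext <;> simp

lemma measurableEmbedding_shift (c : ℝ) :
    MeasurableEmbedding (fun p : ℝ × ℝ => (p.1, p.2 + c)) := by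
  have h := measurableEmbedding_addRight ((0 : ℝ), c)
  convert h using 2 with p
  ext <;> simp

lemma integrableOn_shift {u : ℝ × ℝ → ℝ} {c : ℝ} (hu : ∀ x y, u (x, y + c) = u (x, y))
    {s : Set (ℝ × ℝ)} :
    IntegrableOn u ((fun p : ℝ × ℝ => (p.1, p.2 + c)) ⁻¹' s) ↔ IntegrableOn u s := by
  have h := (measurePreserving_shift c).integrableOn_comp_preimage (measurableEmbedding_shift c)
    (f := u) (s := s)
  have e : u ∘ (fun p : ℝ × ℝ => (p.1, p.2 + c)) = u := by
    ext p; exact hu p.1 p.2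
  rwa [e] at h

lemma integrableOn_odd_cell {L : ℝ} {u : ℝ × ℝ → ℝ}
    (hper : ∀ x y, u (x, y + 2 * L) = u (x, y)) (hu : IntegrableOn u (Cell L)) (n : ℕ) :
    IntegrableOn u (Cell ((2 * n + 1) * L)) := by
  induction n with
  | zero => simpa using hu
  | succ n ih =>
    have hper' : ∀ x y, u (x, y + -(2 * L)) = u (x, y) := fun x y => by
      rw [← hper x (y + -(2 * L))]; congr 2; ring
    have i1 := (integrableOn_shift hper (s := Cell ((2 * n + 1) * L))).2 ih
    have i2 := (integrableOn_shift hper' (s := Cell ((2 * n + 1) * L))).2 ih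
    refine ((i1.union i2).union ih).mono_set ?_
    rintro ⟨x, y⟩ ⟨hx, h1, h2⟩
    push_cast at h1 h2
    by_cases c1 : y ≤ (2 * n + 1) * L
    · by_cases c2 : -((2 * n + 1) * L) < y
      · exact Or.inr ⟨hx, c2, c1⟩
      · push Not at c2
        have hn : (0 : ℝ) ≤ n := n.cast_nonneg
        refine Or.inl (Or.inl ⟨hx, ?_, ?_⟩) <;> simp only <;> nlinarith
    · push Not at c1
      refine Or.inl (Or.inr ⟨hx, ?_, ?_⟩) <;> simp only <;> nlinarith

lemma integrableOn_Strip_of_periodic {L : ℝ} (hL : 0 < L) {u : ℝ × ℝ → ℝ}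
    (hper : ∀ x y, u (x, y + 2 * L) = u (x, y)) (hu : IntegrableOn u (Cell L))
    {φ : ℝ × ℝ → ℝ} (hφ : Continuous φ) (hc : HasCompactSupport φ) :
    IntegrableOn (fun p => u p * φ p) Strip := by
  obtain ⟨R, hR⟩ := hc.isBounded.subset_closedBall 0
  obtain ⟨n, hn⟩ := exists_nat_gt (R / L)
  rw [div_lt_iff₀ hL] at hn
  obtain ⟨C, hC⟩ := hc.exists_bound_of_continuous hφ
  have h1 : IntegrableOn (fun p => u p * φ p) (Cell ((2 * n + 1) * L)) :=
    Integrable.mul_bdd (c := C) (integrableOn_odd_cell hper hu n) hφ.aestronglyMeasurable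
      (ae_of_all _ hC)
  refine h1.of_forall_sdiff_eq_zero measurableSet_Strip ?_
  rintro p ⟨hp1, hp2⟩
  have : φ p = 0 := by
    by_contra h'
    have := hR (subset_tsupport _ h')
    rw [mem_closedBall_zero_iff] at this
    have := (norm_snd_le p).trans this
    rw [Real.norm_eq_abs, abs_le] at this
    exact hp2 ⟨hp1.1, by nlinarith, by nlinarith⟩
  rw [this, mul_zero]

/-- Folding an integral over two periods. -/
lemma integral_Strip_fold {L : ℝ} (hL : 0 < L) {u : ℝ × ℝ → ℝ}
    (hper : ∀ x y, u (x, y + 2 * L) = u (x, y)) (hu : IntegrableOn u (Cell L))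
    {η h : ℝ → ℝ} (hη : Continuous η) (hηc : HasCompactSupport η) (hh : Continuous h)
    (hz : ∀ y, y ∉ Ioc (-L) (3 * L) → h y = 0) :
    ∫ p in Strip, u p * (η p.1 * h p.2) =
      ∫ p in Cell L, u p * (η p.1 * (h p.2 + h (p.2 + 2 * L))) := by
  have hhc : HasCompactSupport h := HasCompactSupport.intro (isCompact_Icc (a := -L) (b := 3 * L))
    fun y hy => hz y fun h' => hy ⟨h'.1.le, h'.2⟩
  have hcont : Continuous fun p : ℝ × ℝ => η p.1 * h p.2 := by fun_prop
  have hcs : HasCompactSupport fun p : ℝ × ℝ => η p.1 * h p.2 :=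
    HasCompactSupport.intro (IsCompact.prod hηc hhc) fun p hp => by
      by_contra h'
      exact hp ⟨subset_tsupport _ (left_ne_zero_of_mul h'),
        subset_tsupport _ (right_ne_zero_of_mul h')⟩
  have hint1 := integrableOn_Strip_of_periodic hL hper hu hcont hcs
  set T : ℝ × ℝ → ℝ × ℝ := fun p => (p.1, p.2 + 2 * L)
  set A : Set (ℝ × ℝ) := Ioo (-1 : ℝ) 1 ×ˢ Ioc L (3 * L)
  have hA : MeasurableSet A := measurableSet_Ioo.prod measurableSet_Ioc
  have hTA : T ⁻¹' A = Cell L := by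
    ext ⟨x, y⟩
    simp only [T, A, Cell, mem_preimage, mem_prod, mem_Ioc]
    constructor <;> rintro ⟨h1, h2, h3⟩ <;> exact ⟨h1, by linarith, by linarith⟩
  have hAS : A ⊆ Strip := prod_mono_right (subset_univ _)
  have hdisj : Disjoint (Cell L) A := by
    rw [Set.disjoint_left]
    rintro p ⟨_, hp⟩ ⟨_, hp'⟩
    exact absurd hp.2 (not_le.2 hp'.1)
  have e1 : ∫ p in Strip, u p * (η p.1 * h p.2) = ∫ p in Cell L ∪ A, u p * (η p.1 * h p.2) := by
    refine setIntegral_eq_of_subset_of_forall_sdiff_eq_zero measurableSet_Strip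
      (union_subset (Cell_subset_Strip L) hAS) ?_
    rintro p ⟨hp1, hp2⟩
    rw [hz p.2, mul_zero, mul_zero]
    intro h'
    refine hp2 ?_
    by_cases c : p.2 ≤ L
    · exact Or.inl ⟨hp1.1, h'.1, c⟩
    · exact Or.inr ⟨hp1.1, not_le.1 c, h'.2⟩
  have e2 : ∫ p in A, u p * (η p.1 * h p.2) = ∫ p in Cell L, u p * (η p.1 * h (p.2 + 2 * L)) := by
    rw [← (measurePreserving_shift (2 * L)).setIntegral_preimage_emb
      (measurableEmbedding_shift (2 * L)), hTA]
    simp only [hper]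
  have hint2 : IntegrableOn (fun p => u p * (η p.1 * h (p.2 + 2 * L))) (Cell L) := by
    have := (hint1.mono_set hAS)
    rw [← (measurePreserving_shift (2 * L)).integrableOn_comp_preimage
      (measurableEmbedding_shift (2 * L)), hTA] at this
    refine this.congr (ae_of_all _ fun p => ?_)
    simp [hper]
  rw [e1, setIntegral_union hdisj hA (hint1.mono_set (Cell_subset_Strip L)) (hint1.mono_set hAS), e2,
    ← integral_add (hint1.mono_set (Cell_subset_Strip L)) hint2]
  congr 1
  ext p
  ring

/-- Smooth cutoff of one period, whose translates form a partition of unity. -/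
def periodCutoff (L n y : ℝ) : ℝ :=
  Real.smoothTransition (n * (y + L) - 1) - Real.smoothTransition (n * (y - L) - 1)

lemma contDiff_periodCutoff (L n : ℝ) : ContDiff ℝ (⊤ : ℕ∞) (periodCutoff L n) := by
  unfold periodCutoff
  exact (Real.smoothTransition.contDiff.comp (by fun_prop)).sub
    (Real.smoothTransition.contDiff.comp (by fun_prop))

lemma periodCutoff_eq_zero {L n y : ℝ} (hL : 0 < L) (hn : 0 < n)
    (hy : y ∉ Icc (-L + n⁻¹) (L + 2 * n⁻¹)) : periodCutoff L n y = 0 := by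
  have e : n * n⁻¹ = 1 := mul_inv_cancel₀ hn.ne'
  unfold periodCutoff
  rcases lt_or_ge y (-L + n⁻¹) with h | h
  · rw [Real.smoothTransition.zero_of_nonpos (by nlinarith),
      Real.smoothTransition.zero_of_nonpos (by nlinarith), sub_zero]
  · have h2 : L + 2 * n⁻¹ < y := by
      by_contra h'; exact hy ⟨h, not_lt.1 h'⟩
    rw [Real.smoothTransition.one_of_one_le (by nlinarith),
      Real.smoothTransition.one_of_one_le (by nlinarith), sub_self]

lemma periodCutoff_add {L n y : ℝ} (hn : 0 < n) (hnL : 1 ≤ n * L) (h1 : -L < y)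
    (h2 : y < L + n⁻¹) : periodCutoff L n y + periodCutoff L n (y + 2 * L) = 1 := by
  have e : n * n⁻¹ = 1 := mul_inv_cancel₀ hn.ne'
  unfold periodCutoff
  rw [show n * (y + 2 * L - L) - 1 = n * (y + L) - 1 by ring,
    Real.smoothTransition.one_of_one_le (x := n * (y + 2 * L + L) - 1) (by nlinarith),
    Real.smoothTransition.zero_of_nonpos (x := n * (y - L) - 1) (by nlinarith)]
  ring

lemma abs_periodCutoff_le (L n y : ℝ) : |periodCutoff L n y| ≤ 1 := by
  unfold periodCutoff
  rw [abs_le]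
  constructor <;> linarith [Real.smoothTransition.nonneg (n * (y + L) - 1),
    Real.smoothTransition.nonneg (n * (y - L) - 1), Real.smoothTransition.le_one (n * (y + L) - 1),
    Real.smoothTransition.le_one (n * (y - L) - 1)]

lemma tendsto_periodCutoff {L : ℝ} (hL : 0 < L) (y : ℝ) :
    Tendsto (fun n : ℕ => periodCutoff L (n + 1 : ℝ) y) atTop (𝓝 ((Ioc (-L) L).indicator 1 y)) := by
  have tt : ∀ c : ℝ, 0 < c → Tendsto (fun n : ℕ => ((n : ℝ) + 1) * c) atTop atTop := fun c hc =>
    (tendsto_atTop_add_const_right _ _ tendsto_natCast_atTop_atTop).atTop_mul_const hc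
  have one : ∀ c : ℝ, 0 < c → ∀ᶠ n : ℕ in atTop,
      Real.smoothTransition (((n : ℝ) + 1) * c - 1) = 1 := fun c hc => by
    filter_upwards [(tt c hc).eventually_ge_atTop 2] with n hn
    exact Real.smoothTransition.one_of_one_le (by linarith)
  have zero : ∀ c : ℝ, c ≤ 0 → ∀ n : ℕ,
      Real.smoothTransition (((n : ℝ) + 1) * c - 1) = 0 := fun c hc n => by
    have : (0 : ℝ) ≤ n := n.cast_nonneg
    exact Real.smoothTransition.zero_of_nonpos (by nlinarith)
  refine tendsto_const_nhds.congr' ?_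
  unfold periodCutoff
  by_cases c1 : -L < y
  · by_cases c2 : y ≤ L
    · filter_upwards [one (y + L) (by linarith)] with n hn
      rw [hn, zero _ (by linarith), indicator_of_mem (by exact ⟨c1, c2⟩)]; simp
    · filter_upwards [one (y + L) (by linarith), one (y - L) (by linarith)] with n hn hn'
      rw [hn, hn', indicator_of_notMem (fun h => c2 h.2)]; simp
  · refine Eventually.of_forall fun n => ?_
    simp only
    rw [zero _ (by linarith), zero _ (by linarith), indicator_of_notMem (fun h => c1 h.1), sub_zero]

lemma iteratedDeriv_eq_zero_of_forall_notMem {s : Set ℝ} (hs : IsClosed s) {f : ℝ → ℝ}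
    (hf : ∀ y, y ∉ s → f y = 0) (j : ℕ) {y : ℝ} (hy : y ∉ s) : iteratedDeriv j f y = 0 := by
  have : f =ᶠ[𝓝 y] fun _ => (0 : ℝ) := by
    filter_upwards [hs.isOpen_compl.mem_nhds hy] with z hz using hf z hz
  rw [this.iteratedDeriv_eq]
  simp

/-- An identity between `g` and `∂_y^j u` tested on compactly supported functions extends to
periodic functions of `y`, the integrals being taken over one period. -/
lemma weak_y_cell {L : ℝ} (hL : 0 < L) {u g : ℝ × ℝ → ℝ}
    (hper : ∀ x y, u (x, y + 2 * L) = u (x, y)) (hu : IntegrableOn u (Cell L))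
    (hg : ∀ φ, IsTest φ → IntegrableOn (fun p => g p * φ p) Strip) {j : ℕ} {σ : ℝ} {η e : ℝ → ℝ}
    (hη : IsTest1D (Ioo (-1) 1) η) (he : ContDiff ℝ (⊤ : ℕ∞) e)
    (heper : ∀ y, e (y + 2 * L) = e y)
    (H : ∀ h : ℝ → ℝ, ContDiff ℝ (⊤ : ℕ∞) h → HasCompactSupport h →
      ∫ p in Strip, g p * (η p.1 * h p.2) =
        σ * ∫ p in Strip, u p * (η p.1 * iteratedDeriv j h p.2)) :
    ∫ p in Cell L, g p * (η p.1 * e p.2) =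
      σ * ∫ p in Cell L, u p * (η p.1 * iteratedDeriv j e p.2) := by
  set h : ℕ → ℝ → ℝ := fun n y => e y * periodCutoff L (n + 1 : ℝ) y with hdef
  have hn : ∀ n : ℕ, (0 : ℝ) < n + 1 := fun n => by positivity
  have hsm : ∀ n, ContDiff ℝ (⊤ : ℕ∞) (h n) := fun n => he.mul (contDiff_periodCutoff _ _)
  have hz : ∀ (n : ℕ) y, y ∉ Icc (-L + ((n : ℝ) + 1)⁻¹) (L + 2 * ((n : ℝ) + 1)⁻¹) → h n y = 0 :=
    fun n y hy => by simp only [hdef]; rw [periodCutoff_eq_zero hL (hn n) hy, mul_zero]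
  have hcs : ∀ n, HasCompactSupport (h n) := fun n =>
    HasCompactSupport.intro isCompact_Icc fun y hy => hz n y hy
  have hev : ∀ᶠ n : ℕ in atTop, 1 ≤ ((n : ℝ) + 1) * L :=
    ((tendsto_atTop_add_const_right _ _ tendsto_natCast_atTop_atTop).atTop_mul_const
      hL).eventually_ge_atTop 1
  have hsub : ∀ n : ℕ, 1 ≤ ((n : ℝ) + 1) * L →
      Icc (-L + ((n : ℝ) + 1)⁻¹) (L + 2 * ((n : ℝ) + 1)⁻¹) ⊆ Ioc (-L) (3 * L) := by
    intro n h1 y hy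
    have h2 : ((n : ℝ) + 1)⁻¹ ≤ L := by
      rw [inv_le_iff_one_le_mul₀ (hn n)]; linarith
    have h3 : 0 < ((n : ℝ) + 1)⁻¹ := inv_pos.2 (hn n)
    exact ⟨by linarith [hy.1], by linarith [hy.2]⟩
  have key : ∀ n : ℕ, 1 ≤ ((n : ℝ) + 1) * L → ∫ p in Strip, g p * (η p.1 * h n p.2) =
      σ * ∫ p in Cell L, u p * (η p.1 * iteratedDeriv j e p.2) := by
    intro n h1
    rw [H _ (hsm n) (hcs n), integral_Strip_fold hL hper hu hη.1.continuous hη.2.1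
      ((hsm n).continuous_iteratedDeriv j (by exact_mod_cast le_top))
      (fun y hy => iteratedDeriv_eq_zero_of_forall_notMem isClosed_Icc (hz n) j
        fun h' => hy (hsub n h1 h'))]
    congr 1
    refine setIntegral_congr_fun (measurableSet_Cell L) fun p hp => ?_
    congr 2
    have hp2 : -L < p.2 := hp.2.1
    have hp3 : p.2 < L + ((n : ℝ) + 1)⁻¹ := lt_of_le_of_lt hp.2.2 (by linarith [inv_pos.2 (hn n)])
    have hE : (fun y => h n y + h n (y + 2 * L)) =ᶠ[𝓝 p.2] e := by
      filter_upwards [isOpen_Ioo.mem_nhds (⟨hp2, hp3⟩ : p.2 ∈ Ioo (-L) (L + ((n : ℝ) + 1)⁻¹))]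
        with y hy
      simp only [hdef]
      rw [heper, ← mul_add, periodCutoff_add (hn n) h1 hy.1 hy.2, mul_one]
    have hshift : ContDiff ℝ (⊤ : ℕ∞) fun y => h n (y + 2 * L) :=
      (hsm n).comp (contDiff_id.add contDiff_const)
    rw [← hE.iteratedDeriv_eq, iteratedDeriv_fun_add
      ((hsm n).contDiffAt.of_le (by exact_mod_cast le_top))
      (hshift.contDiffAt.of_le (by exact_mod_cast le_top)), iteratedDeriv_comp_add_const]
  set χ := plateau (-L - 2) (3 * L + 2) 1
  have hχ : IsTest1D (Ioo (-L - 2) (3 * L + 2)) χ := isTest1D_plateau one_pos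
  have hdom := (hg _ (isTest_mul hη (he.mul hχ.1) hχ.2.1.mul_left)).norm
  have lim : Tendsto (fun n : ℕ => ∫ p in Strip, g p * (η p.1 * h n p.2)) atTop
      (𝓝 (∫ p in Strip, g p * (η p.1 * (e p.2 * (Ioc (-L) L).indicator 1 p.2)))) := by
    refine tendsto_integral_filter_of_dominated_convergence _ ?_ ?_ hdom ?_
    · exact Eventually.of_forall fun n => (hg _ (isTest_mul hη (hsm n) (hcs n))).aestronglyMeasurable
    · filter_upwards [hev] with n h1
      refine ae_of_all _ fun p => ?_
      by_cases hp : p.2 ∈ Ioc (-L) (3 * L)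
      · have : χ p.2 = 1 := plateau_eq_one (by linarith [hp.1]) (by linarith [hp.2])
        rw [this, mul_one, hdef]
        simp only [norm_mul, Real.norm_eq_abs]
        have := abs_periodCutoff_le L (n + 1 : ℝ) p.2
        gcongr
        exact mul_le_of_le_one_right (abs_nonneg _) this
      · rw [hz n p.2 fun h' => hp (hsub n h1 h')]
        simp only [mul_zero, norm_zero]
        positivity
    · refine ae_of_all _ fun p => ?_
      exact ((tendsto_periodCutoff hL p.2).const_mul (e p.2)).const_mul _ |>.const_mul _
  have e1 : ∫ p in Strip, g p * (η p.1 * (e p.2 * (Ioc (-L) L).indicator 1 p.2)) =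
      ∫ p in Cell L, g p * (η p.1 * e p.2) := by
    rw [setIntegral_Strip_eq_Cell (L := L)]
    · refine setIntegral_congr_fun (measurableSet_Cell L) fun p hp => ?_
      rw [indicator_of_mem hp.2, Pi.one_apply, mul_one]
    · intro p hp
      rw [indicator_of_notMem hp]; ring
  rw [← e1]
  refine tendsto_nhds_unique lim (tendsto_const_nhds.congr' ?_)
  filter_upwards [hev] with n h1
  exact (key n h1).symm

/-- If `w ∂_v φ` is always integrable, then a weak derivative `g` of `w` either is integrable
against all test functions, or `w` has vanishing weak derivative. -/
lemma weak_partial_dichotomy {v : ℝ × ℝ} {w g : ℝ × ℝ → ℝ} (h : HasWeakPartial v w g)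
    (hw : ∀ φ, IsTest φ → IntegrableOn (fun p => w p * φ p) Strip) :
    (∀ φ, IsTest φ → IntegrableOn (fun p => g p * φ p) Strip) ∨
      ∀ φ, IsTest φ → ∫ p in Strip, w p * fderiv ℝ φ p v = 0 := by
  refine or_iff_not_imp_left.2 fun hn => ?_
  push Not at hn
  obtain ⟨φ, hφ, hni⟩ := hn
  intro ψ hψ
  have h1 : ∀ ψ, IsTest ψ → ¬ IntegrableOn (fun p => g p * ψ p) Strip →
      ∫ p in Strip, w p * fderiv ℝ ψ p v = 0 := fun ψ hψ hi => by
    rw [h ψ hψ, integral_undef hi, neg_zero]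
  by_cases hi : IntegrableOn (fun p => g p * ψ p) Strip
  · have hsum : IsTest fun p => φ p + ψ p :=
      ⟨hφ.1.add hψ.1, hφ.2.1.add hψ.2.1,
        (tsupport_add φ ψ).trans (union_subset hφ.2.2 hψ.2.2)⟩
    have h2 := h1 _ hsum fun h' => hni <| by
      refine (h'.sub hi).congr (ae_of_all _ fun p => ?_)
      simp only [Pi.sub_apply]
      ring
    have e : ∀ p, fderiv ℝ (fun p => φ p + ψ p) p v = fderiv ℝ φ p v + fderiv ℝ ψ p v := fun p => by
      rw [fderiv_fun_add (hφ.1.differentiable (by simp) p) (hψ.1.differentiable (by simp) p)]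
      rfl
    simp only [e, mul_add] at h2
    rw [integral_add (hw _ (hφ.fderiv_apply v)) (hw _ (hψ.fderiv_apply v)), h1 φ hφ hni,
      zero_add] at h2
    exact h2
  · exact h1 ψ hψ hi

lemma ae_eq_zero_of_forall_isTest1D {a b : ℝ} {f : ℝ → ℝ} (hf : IntegrableOn f (Ioo a b))
    (h : ∀ η, IsTest1D (Ioo a b) η → ∫ x in Ioo a b, f x * η x = 0) :
    ∀ᵐ x ∂volume.restrict (Ioo a b), f x = 0 := by
  rw [ae_restrict_iff' measurableSet_Ioo]
  refine isOpen_Ioo.ae_eq_zero_of_integral_contDiff_smul_eq_zero hf.locallyIntegrableOn ?_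
  intro g g1 g2 g3
  rw [← h g ⟨g1, g2, g3⟩, setIntegral_eq_integral_of_forall_compl_eq_zero]
  · simp only [smul_eq_mul, mul_comm]
  · intro x hx
    rw [image_eq_zero_of_notMem_tsupport fun h' => hx (g3 h'), mul_zero]

/-- The Fourier coefficients of `∂_y² u` control those of `u`. -/
lemma trigCoef_uyy {L : ℝ} (hL : 0 < L) {d : OutData} (hd : MemALout L d) (m : ℤ) :
    ∀ᵐ x ∂volume.restrict (Ioo (-1 : ℝ) 1),
      Freq L m ^ 4 * trigCoef L m d.u x ^ 2 ≤ trigCoef L m d.uyy x ^ 2 := by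
  obtain ⟨hper, -, huy, -, -, huyy, mu, -, muy, -, -, muyy⟩ := hd
  have iu : IntegrableOn d.u (Cell L) := mu.integrable one_le_two
  have ia := (memLp_trigCoef hL m mu).integrable one_le_two
  have ic := (memLp_trigCoef hL m muyy).integrable one_le_two
  have huφ : ∀ φ, IsTest φ → IntegrableOn (fun p => d.u p * φ p) Strip := fun φ hφ =>
    integrableOn_Strip_of_periodic hL hper iu hφ.1.continuous hφ.2.1
  have fD1 : ∀ {η h : ℝ → ℝ}, IsTest1D (Ioo (-1) 1) η → ContDiff ℝ (⊤ : ℕ∞) h →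
      HasCompactSupport h → ∫ p in Strip, d.u p * (η p.1 * iteratedDeriv 2 h p.2) =
        -∫ p in Strip, d.uy p * (η p.1 * deriv h p.2) := by
    intro η h hη hh hc
    have hh' := (contDiff_infty_iff_deriv.1 hh).2
    have := huy _ (isTest_mul hη hh' hc.deriv)
    simp only [fderiv_mul_prod_snd hη.1 hh'] at this
    rw [← this, iteratedDeriv_succ, iteratedDeriv_one]
  have bad : (∀ φ, IsTest φ → ∫ p in Strip, d.uy p * fderiv ℝ φ p (0, 1) = 0) ∨
      (∀ φ, IsTest φ → ∫ p in Strip, d.u p * fderiv ℝ φ p (0, 1) = 0) →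
      ∀ᵐ x ∂volume.restrict (Ioo (-1 : ℝ) 1),
        Freq L m ^ 4 * trigCoef L m d.u x ^ 2 ≤ trigCoef L m d.uyy x ^ 2 := by
    intro hbad
    have hz : ∀ᵐ x ∂volume.restrict (Ioo (-1 : ℝ) 1), Freq L m ^ 2 * trigCoef L m d.u x = 0 := by
      refine ae_eq_zero_of_forall_isTest1D (ia.const_mul _) fun η hη => ?_
      obtain ⟨C, hC⟩ := hη.exists_bound
      have := weak_y_cell hL hper iu (g := fun _ => 0) (by simp) (j := 2) (σ := 1) hη
        (contDiff_trig L m) (trig_periodic hL m) (by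
          intro h hh hc
          simp only [zero_mul, integral_zero, one_mul]
          rcases hbad with hb | hb
          · have := hb _ (isTest_mul hη hh hc)
            simp only [fderiv_mul_prod_snd hη.1 hh] at this
            rw [fD1 hη hh hc, this, neg_zero]
          · have hh' := (contDiff_infty_iff_deriv.1 hh).2
            have := hb _ (isTest_mul hη hh' hc.deriv)
            simp only [fderiv_mul_prod_snd hη.1 hh'] at this
            rw [iteratedDeriv_succ, iteratedDeriv_one, this])
      simp only [mul_assoc]
      rw [integral_const_mul, integral_trigCoef_mul m mu hη.1.continuous hC]
      simp only [zero_mul, integral_zero, one_mul, iteratedDeriv_two_trig] at this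
      have e : ∀ p : ℝ × ℝ, d.u p * (η p.1 * (-(Freq L m ^ 2) * trig L m p.2)) =
        -(Freq L m ^ 2) * (d.u p * (η p.1 * trig L m p.2)) := fun p => by ring
      simp only [e] at this
      rw [integral_const_mul] at this
      linear_combination (2 * L)⁻¹ * this
    filter_upwards [hz] with x hx
    have : Freq L m ^ 4 * trigCoef L m d.u x ^ 2 = (Freq L m ^ 2 * trigCoef L m d.u x) ^ 2 := by
      ring
    rw [this, hx]
    simpa using sq_nonneg _
  rcases weak_partial_dichotomy huy huφ with py | hbad
  swap
  · exact bad (Or.inr hbad)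
  rcases weak_partial_dichotomy huyy py with pyy | byy
  swap
  · exact bad (Or.inl byy)
  have hz : ∀ᵐ x ∂volume.restrict (Ioo (-1 : ℝ) 1),
      trigCoef L m d.uyy x + Freq L m ^ 2 * trigCoef L m d.u x = 0 := by
    refine ae_eq_zero_of_forall_isTest1D (ic.add (ia.const_mul _)) fun η hη => ?_
    obtain ⟨C, hC⟩ := hη.exists_bound
    have := weak_y_cell hL hper iu pyy (j := 2) (σ := 1) hη
      (contDiff_trig L m) (trig_periodic hL m) (by
        intro h hh hc
        have := huyy _ (isTest_mul hη hh hc)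
        simp only [fderiv_mul_prod_snd hη.1 hh] at this
        rw [fD1 hη hh hc, this]; ring)
    have i1 : Integrable (fun x => trigCoef L m d.uyy x * η x) (volume.restrict (Ioo (-1 : ℝ) 1)) :=
      (memLp_trigCoef hL m muyy).integrable_mul_bounded hη.1.continuous.aestronglyMeasurable hC
    have i2 : Integrable (fun x => trigCoef L m d.u x * η x) (volume.restrict (Ioo (-1 : ℝ) 1)) :=
      (memLp_trigCoef hL m mu).integrable_mul_bounded hη.1.continuous.aestronglyMeasurable hC
    simp only [add_mul, mul_assoc]
    rw [integral_add i1 (i2.const_mul _), integral_const_mul,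
      integral_trigCoef_mul m mu hη.1.continuous hC, integral_trigCoef_mul m muyy hη.1.continuous hC,
      this]
    simp only [iteratedDeriv_two_trig]
    have e : ∀ p : ℝ × ℝ, d.u p * (η p.1 * (-(Freq L m ^ 2) * trig L m p.2)) =
      -(Freq L m ^ 2) * (d.u p * (η p.1 * trig L m p.2)) := fun p => by ring
    simp only [e]
    rw [integral_const_mul]
    ring
  filter_upwards [hz] with x hx
  rw [eq_neg_of_add_eq_zero_left hx]
  exact le_of_eq (by ring)

/-- The `y`-average of `∂_y w` vanishes for a periodic function `w`. -/
lemma integral_wy_mul_eq_zero {L : ℝ} (hL : 0 < L) {w g : ℝ × ℝ → ℝ}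
    (hper : ∀ x y, w (x, y + 2 * L) = w (x, y)) (h : HasWeakPartial (0, 1) w g)
    (hw : MemLp w 2 (volume.restrict (Cell L))) (hg : MemLp g 2 (volume.restrict (Cell L)))
    {ζ : ℝ → ℝ} (hζ : Continuous ζ) {C : ℝ} (hC : ∀ x, |ζ x| ≤ C) :
    ∫ p in Cell L, g p * ζ p.1 = 0 := by
  have iw : IntegrableOn w (Cell L) := hw.integrable one_le_two
  have hwφ : ∀ φ, IsTest φ → IntegrableOn (fun p => w p * φ p) Strip := fun φ hφ =>
    integrableOn_Strip_of_periodic hL hper iw hφ.1.continuous hφ.2.1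
  have hz : ∀ᵐ x ∂volume.restrict (Ioo (-1 : ℝ) 1), trigCoef L 0 g x = 0 := by
    refine ae_eq_zero_of_forall_isTest1D ((memLp_trigCoef hL 0 hg).integrable one_le_two)
      fun η hη => ?_
    obtain ⟨C, hC⟩ := hη.exists_bound
    rw [integral_trigCoef_mul 0 hg hη.1.continuous hC]
    simp only [trig_zero, mul_one]
    refine mul_eq_zero_of_right _ ?_
    rcases weak_partial_dichotomy h hwφ with hp | hb
    · have := weak_y_cell hL hper iw hp (j := 1) (σ := -1) (e := fun _ => 1) hη contDiff_const
        (by simp) (by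
          intro h' hh hc
          have := h _ (isTest_mul hη hh hc)
          simp only [fderiv_mul_prod_snd hη.1 hh] at this
          rw [iteratedDeriv_one, this]; ring)
      simpa using this
    · have t := tendsto_integral_mul_plateau hg (g := fun p => η p.1)
        (hη.1.continuous.comp continuous_fst) (fun p _ => hC p.1)
      refine tendsto_nhds_unique t (tendsto_const_nhds.congr fun n => ?_)
      have hn : (0 : ℝ) < n + 1 := by positivity
      have hpl := isTest1D_plateau (α := -L) (β := L) hn
      have hT := isTest_mul hη hpl.1 hpl.2.1
      have e1 := h _ hT
      rw [hb _ hT, setIntegral_Strip_eq_Cell (L := L)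
        (by intro p hp; simp [plateau_eq_zero hn hp])] at e1
      linarith
  have e := integral_trigCoef_mul 0 hg hζ hC
  simp only [trig_zero, mul_one] at e
  have e2 : ∫ x in Ioo (-1 : ℝ) 1, trigCoef L 0 g x * ζ x = 0 :=
    integral_eq_zero_of_ae (hz.mono fun x hx => by simp [hx])
  rw [e2] at e
  have : (2 * L)⁻¹ ≠ 0 := by positivity
  exact (mul_eq_zero.1 e.symm).resolve_left this

/-! ### One-dimensional weak derivatives -/

lemma IsTest1D.exists_Icc {a b : ℝ} (hab : a < b) {φ : ℝ → ℝ} (hφ : IsTest1D (Ioo a b) φ) :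
    ∃ α β, a < α ∧ β < b ∧ ∀ y, y ∉ Icc α β → φ y = 0 := by
  rcases (tsupport φ).eq_empty_or_nonempty with h | h
  · refine ⟨(a + b) / 2, (a + b) / 2, by linarith, by linarith, fun y _ => ?_⟩
    exact image_eq_zero_of_notMem_tsupport (by simp [h])
  · obtain ⟨α, hα⟩ := hφ.2.1.isCompact.exists_isLeast h
    obtain ⟨β, hβ⟩ := hφ.2.1.isCompact.exists_isGreatest h
    refine ⟨α, β, (hφ.2.2 hα.1).1, (hφ.2.2 hβ.1).2, fun y hy => ?_⟩
    exact image_eq_zero_of_notMem_tsupport fun h' => hy ⟨hα.2 h', hβ.2 h'⟩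

lemma isTest1D_primitive {ψ : ℝ → ℝ} (hψ : IsTest1D (Ioo (-1) 1) ψ) (h0 : ∫ x, ψ x = 0) :
    IsTest1D (Ioo (-1) 1) (fun x => ∫ t in (-1 : ℝ)..x, ψ t) ∧
      deriv (fun x => ∫ t in (-1 : ℝ)..x, ψ t) = ψ := by
  obtain ⟨α, β, hα, hβ, hz⟩ := hψ.exists_Icc (by norm_num)
  have hcont := hψ.1.continuous
  have hd : ∀ x, HasDerivAt (fun x => ∫ t in (-1 : ℝ)..x, ψ t) (ψ x) x := fun x =>
    hcont.integral_hasStrictDerivAt (-1) x |>.hasDerivAt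
  have hder : deriv (fun x => ∫ t in (-1 : ℝ)..x, ψ t) = ψ := funext fun x => (hd x).deriv
  have hH : ∀ x, x ∉ Icc α β → ∫ t in (-1 : ℝ)..x, ψ t = 0 := by
    intro x hx
    rcases lt_or_ge x α with h | h
    · refine intervalIntegral.integral_zero_ae (ae_of_all _ fun t ht => hz t fun h' => ?_)
      rw [uIoc, mem_Ioc] at ht
      exact absurd (h'.1.trans ht.2) (not_le.2 (max_lt hα h))
    · have hx' : β < x := by by_contra h'; exact hx ⟨h, not_lt.1 h'⟩
      rw [intervalIntegral.integral_eq_integral_of_support_subset, h0]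
      intro t ht
      have : t ∈ Icc α β := by by_contra h'; exact ht (hz t h')
      exact ⟨lt_of_lt_of_le hα this.1, this.2.trans hx'.le⟩
  refine ⟨⟨?_, HasCompactSupport.intro isCompact_Icc hH, ?_⟩, hder⟩
  · rw [contDiff_infty_iff_deriv, hder]
    exact ⟨fun x => (hd x).differentiableAt, hψ.1⟩
  · refine (closure_minimal (fun x hx => ?_) isClosed_Icc).trans (Icc_subset_Ioo hα hβ)
    by_contra h'
    exact hx (hH x h')

lemma integral_Ioo_eq_intervalIntegral (f : ℝ → ℝ) :
    ∫ x in Ioo (-1 : ℝ) 1, f x = ∫ x in (-1 : ℝ)..1, f x := by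
  rw [intervalIntegral.integral_of_le (by norm_num), integral_Ioc_eq_integral_Ioo]

lemma IsTest1D.integral_eq {ψ : ℝ → ℝ} {a b : ℝ} (hψ : IsTest1D (Ioo a b) ψ) :
    ∫ x in Ioo a b, ψ x = ∫ x, ψ x :=
  setIntegral_eq_integral_of_forall_compl_eq_zero fun _ hx =>
    image_eq_zero_of_notMem_tsupport fun h' => hx (hψ.2.2 h')

/-- A function with vanishing weak derivative is constant. -/
lemma ae_eq_const_of_weak_deriv_zero {f : ℝ → ℝ} (hf : IntegrableOn f (Ioo (-1) 1))
    (h : ∀ η, IsTest1D (Ioo (-1) 1) η → ∫ x in Ioo (-1 : ℝ) 1, f x * deriv η x = 0) :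
    ∃ c, ∀ᵐ x ∂volume.restrict (Ioo (-1 : ℝ) 1), f x = c := by
  set φ₀ := plateau (-1) 1 4
  have h₀ : IsTest1D (Ioo (-1) 1) φ₀ := isTest1D_plateau (by norm_num)
  have hI : 0 < ∫ x, φ₀ x := by
    refine h₀.1.continuous.integral_pos_of_hasCompactSupport_nonneg_nonzero h₀.2.1
      (fun x => plateau_nonneg _ _ _ _) (x := 0) ?_
    rw [show φ₀ 0 = 1 from plateau_eq_one (by norm_num) (by norm_num)]
    norm_num
  have hmul : ∀ {φ : ℝ → ℝ}, IsTest1D (Ioo (-1) 1) φ → IntegrableOn (fun x => f x * φ x) (Ioo (-1) 1) :=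
    fun hφ => by
      obtain ⟨C, hC⟩ := hφ.exists_bound
      exact Integrable.mul_bdd (c := C) hf hφ.1.continuous.aestronglyMeasurable (ae_of_all _ hC)
  set c := (∫ x in Ioo (-1 : ℝ) 1, f x * φ₀ x) / ∫ x, φ₀ x with hc
  refine ⟨c, ?_⟩
  have hfc : IntegrableOn (fun x => f x - c) (Ioo (-1) 1) := hf.sub (integrable_const c)
  refine (ae_eq_zero_of_forall_isTest1D hfc fun φ hφ => ?_).mono fun x hx => sub_eq_zero.1 hx
  set t := (∫ x, φ x) / ∫ x, φ₀ x with ht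
  have iφ := hφ.1.continuous.integrable_of_hasCompactSupport hφ.2.1 (μ := volume)
  have iφ₀ := h₀.1.continuous.integrable_of_hasCompactSupport h₀.2.1 (μ := volume)
  have hψ : IsTest1D (Ioo (-1) 1) fun x => φ x - t * φ₀ x := by
    refine ⟨hφ.1.sub (contDiff_const.mul h₀.1), hφ.2.1.sub h₀.2.1.mul_left, ?_⟩
    refine (tsupport_sub φ fun x => t * φ₀ x).trans (union_subset hφ.2.2 ?_)
    exact (tsupport_mul_subset_right (f := fun _ => t)).trans h₀.2.2
  have hψ0 : ∫ x, (φ x - t * φ₀ x) = 0 := by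
    rw [integral_sub iφ (iφ₀.const_mul t), integral_const_mul, ht]
    field_simp
    ring
  obtain ⟨hH, hHd⟩ := isTest1D_primitive hψ hψ0
  have key := h _ hH
  rw [hHd] at key
  simp only [mul_sub, mul_left_comm _ t] at key
  rw [integral_sub (hmul hφ) ((hmul h₀).const_mul t), integral_const_mul] at key
  simp only [sub_mul]
  rw [integral_sub (hmul hφ) (iφ.integrableOn.const_mul c), integral_const_mul, hφ.integral_eq,
    sub_eq_zero.1 key, hc, ht]
  ring

/-- The chain rule for `a²` for a function `a` with square integrable weak derivative
`b`. -/
lemma weak_deriv_sq {a b : ℝ → ℝ} (ha : IntegrableOn a (Ioo (-1) 1))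
    (hb : IntegrableOn b (Ioo (-1) 1))
    (h : ∀ η, IsTest1D (Ioo (-1) 1) η →
      ∫ x in Ioo (-1 : ℝ) 1, a x * deriv η x = -∫ x in Ioo (-1 : ℝ) 1, b x * η x)
    {η : ℝ → ℝ} (hη : IsTest1D (Ioo (-1) 1) η) :
    ∫ x in Ioo (-1 : ℝ) 1, a x ^ 2 * deriv η x =
      -∫ x in Ioo (-1 : ℝ) 1, 2 * a x * b x * η x := by
  have hbi : IntervalIntegrable b volume (-1) 1 := by
    rwa [intervalIntegrable_iff_integrableOn_Ioo_of_le (by norm_num)]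
  have hAC := hbi.absolutelyContinuousOnInterval_intervalIntegral (c := -1) (by simp)
  set B : ℝ → ℝ := fun x => ∫ t in (-1 : ℝ)..x, b t with hB
  have hBd : ∀ᵐ x, x ∈ uIcc (-1 : ℝ) 1 → HasDerivAt B (b x) x := by
    filter_upwards [hbi.ae_hasDerivAt_integral] with x hx hx'
    exact hx hx' (-1) (by simp)
  have ends : ∀ {φ : ℝ → ℝ}, IsTest1D (Ioo (-1) 1) φ → φ 1 = 0 ∧ φ (-1) = 0 := fun hφ =>
    ⟨image_eq_zero_of_notMem_tsupport fun h' => absurd (hφ.2.2 h').2 (lt_irrefl _),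
      image_eq_zero_of_notMem_tsupport fun h' => absurd (hφ.2.2 h').1 (lt_irrefl _)⟩
  have ibp : ∀ {G g φ : ℝ → ℝ}, AbsolutelyContinuousOnInterval G (-1) 1 →
      (∀ᵐ x, x ∈ uIcc (-1 : ℝ) 1 → HasDerivAt G (g x) x) → IsTest1D (Ioo (-1) 1) φ →
      ∫ x in Ioo (-1 : ℝ) 1, G x * deriv φ x = -∫ x in Ioo (-1 : ℝ) 1, g x * φ x := by
    intro G g φ hG hg hφ
    rw [integral_Ioo_eq_intervalIntegral, integral_Ioo_eq_intervalIntegral,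
      hG.integral_mul_deriv_eq_deriv_mul
        ((hφ.1.of_le (by exact_mod_cast le_top)).contDiffOn.absolutelyContinuousOnInterval),
      (ends hφ).1, (ends hφ).2, mul_zero, mul_zero, sub_self, zero_sub]
    congr 1
    refine intervalIntegral.integral_congr_ae ?_
    filter_upwards [hg] with x hx hx'
    rw [(hx (uIoc_subset_uIcc hx')).deriv]
  have iB : IntegrableOn B (Ioo (-1) 1) := by
    have : IntegrableOn B (uIcc (-1 : ℝ) 1) := hAC.continuousOn.integrableOn_uIcc
    exact this.mono_set (by rw [uIcc_of_le (by norm_num)]; exact Ioo_subset_Icc_self)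
  obtain ⟨c, hc⟩ := ae_eq_const_of_weak_deriv_zero (f := fun x => a x - B x) (ha.sub iB)
    fun φ hφ => by
      obtain ⟨C, hC⟩ := hφ.deriv.exists_bound
      have m1 : IntegrableOn (fun x => a x * deriv φ x) (Ioo (-1) 1) :=
        Integrable.mul_bdd (c := C) ha hφ.deriv.1.continuous.aestronglyMeasurable (ae_of_all _ hC)
      have m2 : IntegrableOn (fun x => B x * deriv φ x) (Ioo (-1) 1) :=
        Integrable.mul_bdd (c := C) iB hφ.deriv.1.continuous.aestronglyMeasurable (ae_of_all _ hC)
      simp only [sub_mul]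
      rw [integral_sub m1 m2, h φ hφ, ibp hAC hBd hφ, sub_self]
  have hG : AbsolutelyContinuousOnInterval (fun x => B x + c) (-1) 1 :=
    hAC.add (contDiffOn_const.absolutelyContinuousOnInterval)
  have hGG := hG.fun_mul hG
  have key := ibp (g := fun x => 2 * (B x + c) * b x) hGG (by
    filter_upwards [hBd] with x hx hx'
    refine (((hx hx').add_const c).fun_mul ((hx hx').add_const c)).congr_deriv ?_
    ring) hη
  have e1 : ∫ x in Ioo (-1 : ℝ) 1, a x ^ 2 * deriv η x =
      ∫ x in Ioo (-1 : ℝ) 1, (B x + c) * (B x + c) * deriv η x := by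
    refine integral_congr_ae ?_
    filter_upwards [hc] with x hx
    rw [show a x = B x + c by linarith]
    ring
  have e2 : ∫ x in Ioo (-1 : ℝ) 1, 2 * a x * b x * η x =
      ∫ x in Ioo (-1 : ℝ) 1, 2 * (B x + c) * b x * η x := by
    refine integral_congr_ae ?_
    filter_upwards [hc] with x hx
    rw [show a x = B x + c by linarith]
  rw [e1, e2, key]

lemma weak_deriv_quadratic_bound {a b : ℝ → ℝ} (ha : MemLp a 2 (volume.restrict (Ioo (-1 : ℝ) 1)))
    (hb : MemLp b 2 (volume.restrict (Ioo (-1 : ℝ) 1)))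
    (h : ∀ η, IsTest1D (Ioo (-1) 1) η →
      ∫ x in Ioo (-1 : ℝ) 1, a x * deriv η x = -∫ x in Ioo (-1 : ℝ) 1, b x * η x)
    {η : ℝ → ℝ} (hη : IsTest1D (Ioo (-1) 1) η) :
    ∫ x in Ioo (-1 : ℝ) 1, a x ^ 2 * (-(η x ^ 2) - deriv η x) ≤ ∫ x in Ioo (-1 : ℝ) 1, b x ^ 2 := by
  obtain ⟨C, hC⟩ := hη.exists_bound
  obtain ⟨D, hD⟩ := hη.deriv.exists_bound
  have hηm := hη.1.continuous.aestronglyMeasurable (μ := volume.restrict (Ioo (-1 : ℝ) 1))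
  have hη'm := hη.deriv.1.continuous.aestronglyMeasurable (μ := volume.restrict (Ioo (-1 : ℝ) 1))
  have ia2 := ha.integrable_sq
  have ib2 := hb.integrable_sq
  have iab : Integrable (fun x => a x * b x) (volume.restrict (Ioo (-1 : ℝ) 1)) :=
    ha.integrable_mul hb
  have i1 : Integrable (fun x => a x ^ 2 * deriv η x) (volume.restrict (Ioo (-1 : ℝ) 1)) :=
    Integrable.mul_bdd (c := D) ia2 hη'm (ae_of_all _ hD)
  have i2 : Integrable (fun x => 2 * a x * b x * η x) (volume.restrict (Ioo (-1 : ℝ) 1)) :=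
    Integrable.mul_bdd (c := C) (f := fun x => 2 * a x * b x)
      ((iab.const_mul 2).congr (ae_of_all _ fun x => by simp only; ring)) hηm (ae_of_all _ hC)
  have i3 : Integrable (fun x => a x ^ 2 * η x ^ 2) (volume.restrict (Ioo (-1 : ℝ) 1)) := by
    have := Integrable.mul_bdd (c := C) (Integrable.mul_bdd (c := C) ia2 hηm (ae_of_all _ hC)) hηm
      (ae_of_all _ hC)
    exact this.congr (ae_of_all _ fun x => by simp only; ring)
  have key := weak_deriv_sq (ha.integrable one_le_two) (hb.integrable one_le_two) h hη
  have e1 : ∫ x in Ioo (-1 : ℝ) 1, a x ^ 2 * (-(η x ^ 2) - deriv η x) =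
      -(∫ x in Ioo (-1 : ℝ) 1, a x ^ 2 * η x ^ 2) + ∫ x in Ioo (-1 : ℝ) 1, 2 * a x * b x * η x := by
    simp only [mul_sub, mul_neg]
    have i3' : Integrable (fun x => -(a x ^ 2 * η x ^ 2)) (volume.restrict (Ioo (-1 : ℝ) 1)) := i3.neg
    rw [integral_sub i3' i1, integral_neg, key]
    ring
  have e2 : 0 ≤ ∫ x in Ioo (-1 : ℝ) 1, (b x - a x * η x) ^ 2 :=
    integral_nonneg fun x => sq_nonneg _
  have e3 : ∫ x in Ioo (-1 : ℝ) 1, (b x - a x * η x) ^ 2 = (∫ x in Ioo (-1 : ℝ) 1, b x ^ 2) -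
      (∫ x in Ioo (-1 : ℝ) 1, 2 * a x * b x * η x) + ∫ x in Ioo (-1 : ℝ) 1, a x ^ 2 * η x ^ 2 := by
    have i4 : Integrable (fun x => b x ^ 2 - 2 * a x * b x * η x)
      (volume.restrict (Ioo (-1 : ℝ) 1)) := ib2.sub i2
    rw [← integral_sub ib2 i2, ← integral_add i4 i3]
    congr 1
    ext x
    ring
  linarith

/-! ### The lower bound tested by smooth functions -/

/-- The integrand of the dual formulation of `Finfty`. -/
def dualDensity (χ ψ : ℝ × ℝ → ℝ) (p : ℝ × ℝ) : ℝ :=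
  p.2 ^ 2 * χ p - p.2 ^ 2 * ψ p ^ 2 - dX ψ p

lemma IsTest.slice {ψ : ℝ × ℝ → ℝ} (hψ : IsTest ψ) (k : ℝ) :
    IsTest1D (Ioo (-1) 1) fun x => ψ (x, k) := by
  have hsub : (tsupport fun x => ψ (x, k)) ⊆ Prod.fst '' tsupport ψ := by
    refine closure_minimal (fun x hx => ⟨(x, k), subset_tsupport _ hx, rfl⟩) ?_
    exact (hψ.2.1.isCompact.image continuous_fst).isClosed
  refine ⟨hψ.1.comp (contDiff_id.prodMk contDiff_const), ?_, fun x hx => ?_⟩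
  · exact (hψ.2.1.isCompact.image continuous_fst).of_isClosed_subset (isClosed_tsupport _) hsub
  · obtain ⟨p, hp, rfl⟩ := hsub hx
    exact (hψ.2.2 hp).1

lemma deriv_slice {ψ : ℝ × ℝ → ℝ} (hψ : ContDiff ℝ (⊤ : ℕ∞) ψ) (x k : ℝ) :
    deriv (fun x => ψ (x, k)) x = dX ψ (x, k) := by
  have h1 : HasFDerivAt ψ (fderiv ℝ ψ (x, k)) (x, k) :=
    (hψ.differentiable (by simp) _).hasFDerivAt
  have h2 : HasDerivAt (fun x : ℝ => (x, k)) ((1 : ℝ), (0 : ℝ)) x :=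
    (hasDerivAt_id x).prodMk (hasDerivAt_const x k)
  exact (h1.comp_hasDerivAt x h2).deriv

lemma continuous_dX {ψ : ℝ × ℝ → ℝ} (hψ : IsTest ψ) : Continuous (dX ψ) :=
  (hψ.fderiv_apply (1, 0)).1.continuous

lemma continuous_dualDensity {χ ψ : ℝ × ℝ → ℝ} (hχ : IsTest χ) (hψ : IsTest ψ) :
    Continuous (dualDensity χ ψ) := by
  have h1 := hχ.1.continuous
  have h2 := hψ.1.continuous
  have h3 := continuous_dX hψ
  unfold dualDensity
  fun_prop

lemma hasCompactSupport_dualDensity {χ ψ : ℝ × ℝ → ℝ} (hχ : IsTest χ) (hψ : IsTest ψ) :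
    HasCompactSupport (dualDensity χ ψ) := by
  have h3 : HasCompactSupport (dX ψ) := (hψ.fderiv_apply (1, 0)).2.1
  have h2 : HasCompactSupport fun p => ψ p ^ 2 := hψ.2.1.comp_left (g := (· ^ 2)) (by simp)
  exact ((HasCompactSupport.mul_left hχ.2.1).sub (HasCompactSupport.mul_left h2)).sub h3

lemma weak_deriv_trigCoef {L : ℝ} {d : OutData} (hd : MemALout L d) (m : ℤ) {η : ℝ → ℝ}
    (hη : IsTest1D (Ioo (-1) 1) η) :
    ∫ x in Ioo (-1 : ℝ) 1, trigCoef L m d.u x * deriv η x =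
      -∫ x in Ioo (-1 : ℝ) 1, trigCoef L m d.ux x * η x := by
  obtain ⟨C, hC⟩ := hη.exists_bound
  obtain ⟨D, hD⟩ := hη.deriv.exists_bound
  obtain ⟨-, hux, -, -, -, -, mu, mux, -⟩ := hd
  rw [integral_trigCoef_mul m mu hη.deriv.1.continuous hD,
    integral_trigCoef_mul m mux hη.1.continuous hC,
    weak_x_cell hux mu mux hη (contDiff_trig L m) (abs_trig_le L m), mul_neg]

lemma integral_aWeight_mul_dualDensity_le {L : ℝ} (hL : 0 < L) {d : OutData} (hd : MemALout L d)
    {χ ψ : ℝ × ℝ → ℝ} (hχ : IsTest χ) (hψ : IsTest ψ) (hχ1 : ∀ p, χ p ≤ 1) (m : ℤ) :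
    ∫ x in Ioo (-1 : ℝ) 1, aWeight L d.u m x * dualDensity χ ψ (x, Freq L m) ≤
      (∫ x in Ioo (-1 : ℝ) 1, trigCoef L m d.ux x ^ 2) +
        ∫ x in Ioo (-1 : ℝ) 1, trigCoef L m d.uyy x ^ 2 := by
  have hwk := fun η (hη : IsTest1D (Ioo (-1) 1) η) => weak_deriv_trigCoef hd m hη
  have hc := trigCoef_uyy hL hd m
  obtain ⟨-, -, -, -, -, -, mu, mux, -, -, -, muyy⟩ := hd
  set k := Freq L m
  have hη : IsTest1D (Ioo (-1) 1) fun x => k ^ 2 * ψ (x, k) := by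
    have := hψ.slice k
    exact ⟨contDiff_const.mul this.1, this.2.1.mul_left,
      (tsupport_mul_subset_right (f := fun _ => k ^ 2)).trans this.2.2⟩
  have ma := memLp_trigCoef hL m mu
  have mc := memLp_trigCoef hL m muyy
  have key := weak_deriv_quadratic_bound ma (memLp_trigCoef hL m mux) hwk hη
  have hder : ∀ x, deriv (fun x => k ^ 2 * ψ (x, k)) x = k ^ 2 * dX ψ (x, k) := fun x => by
    rw [deriv_const_mul_field, deriv_slice hψ.1]
  have hcs := hχ.slice k
  obtain ⟨C, hC⟩ := hcs.exists_bound
  obtain ⟨D, hD⟩ := hη.exists_bound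
  obtain ⟨E, hE⟩ := hη.deriv.exists_bound
  have ia := ma.integrable_sq
  have i1 : Integrable (fun x => k ^ 4 * (trigCoef L m d.u x ^ 2 * χ (x, k)))
      (volume.restrict (Ioo (-1 : ℝ) 1)) :=
    (Integrable.mul_bdd (c := C) ia hcs.1.continuous.aestronglyMeasurable (ae_of_all _ hC)).const_mul _
  have i2 : Integrable (fun x => trigCoef L m d.u x ^ 2 *
      (-((k ^ 2 * ψ (x, k)) ^ 2) - deriv (fun x => k ^ 2 * ψ (x, k)) x))
      (volume.restrict (Ioo (-1 : ℝ) 1)) := by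
    refine Integrable.mul_bdd (c := D ^ 2 + E) ia ?_ (ae_of_all _ fun x => ?_)
    · exact (((hη.1.continuous.pow 2).neg).sub hη.deriv.1.continuous).aestronglyMeasurable
    · refine (norm_sub_le _ _).trans (add_le_add ?_ (hE x))
      rw [norm_neg, norm_pow]
      exact pow_le_pow_left₀ (norm_nonneg _) (hD x) 2
  have e : ∫ x in Ioo (-1 : ℝ) 1, aWeight L d.u m x * dualDensity χ ψ (x, k) =
      (∫ x in Ioo (-1 : ℝ) 1, trigCoef L m d.u x ^ 2 *
        (-((k ^ 2 * ψ (x, k)) ^ 2) - deriv (fun x => k ^ 2 * ψ (x, k)) x)) +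
      ∫ x in Ioo (-1 : ℝ) 1, k ^ 4 * (trigCoef L m d.u x ^ 2 * χ (x, k)) := by
    rw [← integral_add i2 i1]
    congr 1
    ext x
    rw [hder, aWeight, fourierCoef_eq_trigCoef hL, dualDensity]
    ring
  rw [e]
  refine add_le_add key (integral_mono_ae i1 mc.integrable_sq ?_)
  filter_upwards [hc] with x hx
  refine le_trans ?_ hx
  rw [← mul_assoc]
  exact mul_le_of_le_one_right (by positivity) (hχ1 _)

lemma muLpair_dualDensity_le {L : ℝ} (hL : 0 < L) {d : OutData} (hd : MemALout L d)
    {χ ψ : ℝ × ℝ → ℝ} (hχ : IsTest χ) (hψ : IsTest ψ) (hχ1 : ∀ p, χ p ≤ 1) :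
    muLpair L d.u (dualDensity χ ψ) ≤
      (2 * L)⁻¹ * ∫ p in Cell L, (d.ux p ^ 2 + d.uyy p ^ 2) := by
  obtain ⟨R, hR⟩ := (hasCompactSupport_dualDensity hχ hψ).isBounded.subset_closedBall 0
  obtain ⟨N, hN⟩ := exists_nat_gt (R * L / Real.pi)
  rw [div_lt_iff₀ Real.pi_pos] at hN
  have hz : ∀ m : ℤ, m ∉ Finset.Icc (-(N : ℤ)) N → ∀ x, dualDensity χ ψ (x, Freq L m) = 0 := by
    intro m hm x
    by_contra h'
    have h1 := hR (subset_tsupport _ h')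
    rw [mem_closedBall_zero_iff] at h1
    have h2 := (norm_snd_le (x, Freq L m)).trans h1
    rw [Real.norm_eq_abs, Freq, abs_div, abs_mul, abs_of_pos hL, abs_of_pos Real.pi_pos,
      div_le_iff₀ hL] at h2
    refine hm (Finset.mem_Icc.2 (abs_le.1 ?_))
    have h3 : Real.pi * |(m : ℝ)| < Real.pi * N := by linarith
    have h4 : |(m : ℝ)| < N := lt_of_mul_lt_mul_left h3 Real.pi_pos.le
    exact_mod_cast h4.le
  unfold muLpair
  rw [tsum_eq_sum (s := Finset.Icc (-(N : ℤ)) N) fun m hm => by simp [hz m hm]]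
  refine (Finset.sum_le_sum fun m _ =>
    integral_aWeight_mul_dualDensity_le hL hd hχ hψ hχ1 m).trans ?_
  obtain ⟨-, -, -, -, -, -, mu, mux, -, -, -, muyy⟩ := hd
  rw [Finset.sum_add_distrib, integral_add mux.integrable_sq muyy.integrable_sq, mul_add]
  exact add_le_add (sum_integral_trigCoef_sq_le hL _ mux) (sum_integral_trigCoef_sq_le hL _ muyy)

/-! ### The energy bounds the out-of-plane terms -/

lemma integral_Cell_fst {L : ℝ} (hL : 0 < L) (f : ℝ → ℝ) :
    ∫ p in Cell L, f p.1 = 2 * L * ∫ x in Ioo (-1 : ℝ) 1, f x := by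
  have := integral_prod_mul (μ := volume.restrict (Ioo (-1 : ℝ) 1))
    (ν := volume.restrict (Ioc (-L) L)) f (fun _ => (1 : ℝ))
  simp only [mul_one] at this
  rw [volume_restrict_Cell, this, integral_const, smul_eq_mul, mul_one, mul_comm,
    measureReal_restrict_apply_univ, Real.volume_real_Ioc_of_le (by linarith)]
  ring

lemma integral_negPart_sq : ∫ x in Ioo (-1 : ℝ) 1, min (max (-x) 0) 1 ^ 2 = 1 / 3 := by
  have hc : Continuous fun x : ℝ => min (max (-x) 0) 1 ^ 2 := by fun_prop
  rw [integral_Ioo_eq_intervalIntegral, ← intervalIntegral.integral_add_adjacent_intervals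
    (b := 0) (hc.intervalIntegrable _ _) (hc.intervalIntegrable _ _)]
  have e1 : ∫ x in (-1 : ℝ)..0, min (max (-x) 0) 1 ^ 2 = ∫ x in (-1 : ℝ)..0, x ^ 2 := by
    refine intervalIntegral.integral_congr fun x hx => ?_
    rw [uIcc_of_le (by norm_num)] at hx
    rw [max_eq_left (by linarith [hx.2]), min_eq_left (by linarith [hx.1]), neg_sq]
  have e2 : ∫ x in (0 : ℝ)..1, min (max (-x) 0) 1 ^ 2 = ∫ x in (0 : ℝ)..1, 0 := by
    refine intervalIntegral.integral_congr fun x hx => ?_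
    rw [uIcc_of_le (by norm_num)] at hx
    rw [max_eq_right (by linarith [hx.1]), min_eq_left (by norm_num)]
    norm_num
  rw [e1, e2, integral_pow]
  norm_num

lemma FL_lower_bound {L : ℝ} (hL : 0 < L) {w : InData} {d : OutData} (hw : MemALin L w)
    (hd : MemALout L d) :
    FL L w d = L ^ 2 * (5 / 3) ∨
      (2 * L)⁻¹ * ∫ p in Cell L, (d.ux p ^ 2 + d.uyy p ^ 2) ≤ FL L w d := by
  unfold FL energyEL
  set I : ℝ × ℝ → ℝ := fun p => (((w.w1x p + (d.ux p) ^ 2 / (2 * L ^ 2) - 1) ^ 2 - 1)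
      + (w.w2y p + (d.uy p) ^ 2 / 2 - p.1) ^ 2
      + (L ^ 2)⁻¹ * (L ^ 2 * w.w1y p + w.w2x p + d.ux p * d.uy p) ^ 2
      + (L ^ 2)⁻¹ * ((d.ux p) ^ 2 + (d.uyy p) ^ 2)
      + (L ^ 4)⁻¹ * (2 * (d.uxy p) ^ 2 + (L ^ 2)⁻¹ * (d.uxx p) ^ 2)) with hI
  by_cases hi : Integrable I (volume.restrict (Cell L))
  swap
  · left
    rw [integral_undef hi]
    ring
  right
  obtain ⟨-, hper, -, -, -, hwy, -, m2, -, -, -, m2y⟩ := hw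
  obtain ⟨-, -, -, -, -, -, -, mux, -, -, -, muyy⟩ := hd
  set ζ : ℝ → ℝ := fun x => min (max (-x) 0) 1 with hζ
  have hζc : Continuous ζ := by fun_prop
  have hζ1 : ∀ x, |ζ x| ≤ 1 := fun x => by
    rw [abs_of_nonneg (le_min (le_max_right _ _) zero_le_one)]
    exact min_le_right _ _
  have z0 := integral_wy_mul_eq_zero hL hper hwy m2 m2y hζc hζ1
  have i1 : Integrable (fun p : ℝ × ℝ => w.w2y p * ζ p.1) (volume.restrict (Cell L)) :=
    m2y.integrable_mul_bounded (hζc.comp continuous_fst).aestronglyMeasurable fun p => hζ1 p.1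
  have i2 : Integrable (fun p : ℝ × ℝ => ζ p.1 ^ 2 - 1) (volume.restrict (Cell L)) := by
    refine Integrable.of_bound (C := 2) (by fun_prop) (ae_of_all _ fun p => ?_)
    have h1 := hζ1 p.1
    rw [← sq_le_one_iff_abs_le_one] at h1
    rw [Real.norm_eq_abs, abs_le]
    constructor <;> nlinarith [sq_nonneg (ζ p.1)]
  have i3 : Integrable (fun p => d.ux p ^ 2 + d.uyy p ^ 2) (volume.restrict (Cell L)) :=
    mux.integrable_sq.add muyy.integrable_sq
  have i12 : Integrable (fun p : ℝ × ℝ => 2 * (w.w2y p * ζ p.1) + (ζ p.1 ^ 2 - 1))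
      (volume.restrict (Cell L)) := (i1.const_mul 2).add i2
  have hle : ∫ p in Cell L, ((2 * (w.w2y p * ζ p.1) + (ζ p.1 ^ 2 - 1)) +
      (L ^ 2)⁻¹ * (d.ux p ^ 2 + d.uyy p ^ 2)) ≤ ∫ p in Cell L, I p := by
    refine setIntegral_mono_on (i12.add (i3.const_mul _)) hi (measurableSet_Cell L) fun p hp => ?_
    have hx1 : -1 < p.1 := hp.1.1
    have hz0 : 0 ≤ ζ p.1 := le_min (le_max_right _ _) zero_le_one
    have hz : p.1 * ζ p.1 = -ζ p.1 ^ 2 := by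
      simp only [hζ]
      rcases le_total p.1 0 with h | h
      · rw [max_eq_left (by linarith), min_eq_left (by linarith)]; ring
      · rw [max_eq_right (by linarith), min_eq_left (by norm_num)]; ring
    have hB : 2 * (w.w2y p * ζ p.1) + ζ p.1 ^ 2 ≤ (w.w2y p + (d.uy p) ^ 2 / 2 - p.1) ^ 2 := by
      nlinarith [sq_nonneg (w.w2y p + (d.uy p) ^ 2 / 2 - p.1 - ζ p.1),
        mul_nonneg (sq_nonneg (d.uy p)) hz0]
    have n1 : 0 ≤ (w.w1x p + (d.ux p) ^ 2 / (2 * L ^ 2) - 1) ^ 2 := sq_nonneg _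
    have n2 : 0 ≤ (L ^ 2)⁻¹ * (L ^ 2 * w.w1y p + w.w2x p + d.ux p * d.uy p) ^ 2 := by positivity
    have n3 : 0 ≤ (L ^ 4)⁻¹ * (2 * (d.uxy p) ^ 2 + (L ^ 2)⁻¹ * (d.uxx p) ^ 2) := by positivity
    simp only [hI]
    linarith
  have e2 : ∫ p in Cell L, (ζ p.1 ^ 2 - 1) = 2 * L * (-5 / 3) := by
    rw [integral_Cell_fst hL fun x => ζ x ^ 2 - 1, integral_sub, integral_negPart_sq]
    · rw [integral_const, measureReal_restrict_apply_univ,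
        Real.volume_real_Ioo_of_le (by norm_num), smul_eq_mul]
      ring
    · refine Integrable.of_bound (C := 1) (by fun_prop) (ae_of_all _ fun x => ?_)
      rw [norm_pow]
      exact pow_le_one₀ (norm_nonneg _) (hζ1 x)
    · exact integrable_const _
  rw [integral_add i12 (i3.const_mul _), integral_add (i1.const_mul 2) i2, integral_const_mul, z0,
    e2, integral_const_mul] at hle
  set X := ∫ p in Cell L, (d.ux p ^ 2 + d.uyy p ^ 2)
  have h2 := mul_le_mul_of_nonneg_left hle (by positivity : 0 ≤ L ^ 2 * (2 * L)⁻¹)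
  have h3 : L ^ 2 * (2 * L)⁻¹ * (2 * 0 + 2 * L * (-5 / 3) + (L ^ 2)⁻¹ * X) =
      (2 * L)⁻¹ * X - L ^ 2 * (5 / 3) := by
    field_simp
    ring
  rw [h3] at h2
  linarith

/-! ### Duality for the limit functional -/

/-- A bounded integrable function is an a.e. limit of uniformly bounded smooth functions. -/
lemma exists_contDiff_tendsto_ae {μ : Measure (ℝ × ℝ)} [IsFiniteMeasure μ] {g : ℝ × ℝ → ℝ}
    (hg : Measurable g) {M : ℝ} (hM : ∀ p, |g p| ≤ M) :
    ∃ φ : ℕ → ℝ × ℝ → ℝ, (∀ n, ContDiff ℝ (⊤ : ℕ∞) (φ n)) ∧ (∀ n p, |φ n p| ≤ M + 1) ∧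
      ∀ᵐ p ∂μ, Tendsto (fun n => φ n p) atTop (𝓝 (g p)) := by
  have hM0 : 0 ≤ M := (abs_nonneg _).trans (hM 0)
  have hgL : MemLp g 1 μ := MemLp.of_bound hg.aestronglyMeasurable M (ae_of_all _ hM)
  have hpos : ∀ n : ℕ, ENNReal.ofReal (1 / ((n : ℝ) + 1)) ≠ 0 := fun n =>
    (ENNReal.ofReal_pos.2 (by positivity)).ne'
  choose c _ hcl hcc _ using fun n : ℕ =>
    hgL.exists_hasCompactSupport_eLpNorm_sub_le ENNReal.one_ne_top (hpos n)
  have hlim : Tendsto (fun n : ℕ => ENNReal.ofReal (1 / ((n : ℝ) + 1))) atTop (𝓝 0) := by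
    simpa using ENNReal.tendsto_ofReal (tendsto_one_div_add_atTop_nhds_zero_nat (𝕜 := ℝ))
  have hme : TendstoInMeasure μ c atTop g := by
    refine tendstoInMeasure_of_tendsto_eLpNorm one_ne_zero
      (fun n => (hcc n).aestronglyMeasurable) hgL.1 ?_
    refine tendsto_of_tendsto_of_tendsto_of_le_of_le tendsto_const_nhds hlim (fun _ => bot_le)
      fun n => ?_
    rw [eLpNorm_sub_comm]
    exact hcl n
  obtain ⟨ns, -, hns⟩ := hme.exists_seq_tendsto_ae
  have hcl' : ∀ n, Continuous fun p => max (-M) (min (c (ns n) p) M) := fun n =>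
    continuous_const.max ((hcc _).min continuous_const)
  choose φ hφ hφd using fun n : ℕ => (hcl' n).exists_contDiff_approx (⊤ : ℕ∞)
    (continuous_const (y := 1 / ((n : ℝ) + 1))) fun _ => by positivity
  refine ⟨φ, hφ, fun n p => ?_, ?_⟩
  · have h1 := ((hφd n).1 p).le
    rw [Real.dist_eq] at h1
    have h2 : |max (-M) (min (c (ns n) p) M)| ≤ M :=
      abs_le.2 ⟨le_max_left _ _, max_le (by linarith) (min_le_right _ _)⟩
    have h3 : 1 / ((n : ℝ) + 1) ≤ 1 := by
      rw [div_le_one (by positivity)]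
      linarith [Nat.cast_nonneg (α := ℝ) n]
    have h4 := abs_sub_abs_le_abs_sub (φ n p) (max (-M) (min (c (ns n) p) M))
    linarith
  · filter_upwards [hns] with p hp
    have h1 : Tendsto (fun n => max (-M) (min (c (ns n) p) M)) atTop (𝓝 (g p)) := by
      have := (tendsto_const_nhds (x := -M)).max (hp.min (tendsto_const_nhds (x := M)))
      rwa [min_eq_left (abs_le.1 (hM p)).2, max_eq_right (abs_le.1 (hM p)).1] at this
    refine h1.congr_dist ?_
    refine squeeze_zero (fun _ => dist_nonneg) (fun n => ?_)
      (tendsto_one_div_add_atTop_nhds_zero_nat (𝕜 := ℝ))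
    rw [dist_comm]
    exact ((hφd n).1 p).le

/-- Integrability of the integrand in the dual formulation of `Finfty`. -/
lemma integrable_dual {μ : Measure (ℝ × ℝ)} [IsFiniteMeasure μ] {f χ g : ℝ × ℝ → ℝ}
    (hf : Integrable f μ) (hχ : Measurable χ) (hg : Measurable g) {K M : ℝ}
    (hχ1 : ∀ p, |χ p| ≤ 1) (hK : ∀ p, χ p ≠ 0 → |p.2| ≤ K) (hM : ∀ p, |g p| ≤ M)
    (hgχ : ∀ p, χ p = 0 → g p = 0) :
    Integrable (fun p => p.2 ^ 2 * χ p - p.2 ^ 2 * g p ^ 2 + g p * f p) μ := by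
  have hM0 : 0 ≤ M := (abs_nonneg _).trans (hM 0)
  have b1 : ∀ p : ℝ × ℝ, |p.2 ^ 2 * χ p - p.2 ^ 2 * g p ^ 2| ≤ K ^ 2 * (1 + M ^ 2) := by
    intro p
    by_cases h : χ p = 0
    · rw [h, hgχ p h]
      simp
      positivity
    · have h1 : p.2 ^ 2 ≤ K ^ 2 := sq_le_sq.2 ((hK p h).trans (le_abs_self K))
      have h2 : g p ^ 2 ≤ M ^ 2 := sq_le_sq.2 ((hM p).trans (le_abs_self M))
      rw [← mul_sub, abs_mul, abs_of_nonneg (sq_nonneg p.2)]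
      refine mul_le_mul h1 ?_ (abs_nonneg _) (sq_nonneg K)
      refine (abs_sub _ _).trans (add_le_add (hχ1 p) ?_)
      rwa [abs_of_nonneg (sq_nonneg (g p))]
  have i1 : Integrable (fun p : ℝ × ℝ => p.2 ^ 2 * χ p - p.2 ^ 2 * g p ^ 2) μ :=
    Integrable.of_bound (C := K ^ 2 * (1 + M ^ 2)) (by fun_prop) (ae_of_all _ b1)
  exact i1.add (hf.bdd_mul (c := M) hg.aestronglyMeasurable (ae_of_all _ hM))

lemma ofReal_integral_dual_le {μ : Measure (ℝ × ℝ)} [IsFiniteMeasure μ] {f : ℝ × ℝ → ℝ}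
    (hf : Integrable f μ) {C : ℝ≥0∞}
    (h : ∀ χ ψ, IsTest χ → IsTest ψ → (∀ p, 0 ≤ χ p) → (∀ p, χ p ≤ 1) →
      ENNReal.ofReal (∫ p, (p.2 ^ 2 * χ p - p.2 ^ 2 * ψ p ^ 2 + ψ p * f p) ∂μ) ≤ C)
    {χ g : ℝ × ℝ → ℝ} (hχ : IsTest χ) (hχ0 : ∀ p, 0 ≤ χ p) (hχ1 : ∀ p, χ p ≤ 1)
    (hg : Measurable g) {K M : ℝ} (hK : ∀ p, χ p ≠ 0 → |p.2| ≤ K) (hM : ∀ p, |g p| ≤ M)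
    (hgχ : ∀ p, χ p * g p = g p) :
    ENNReal.ofReal (∫ p, (p.2 ^ 2 * χ p - p.2 ^ 2 * g p ^ 2 + g p * f p) ∂μ) ≤ C := by
  have hM0 : 0 ≤ M := (abs_nonneg _).trans (hM 0)
  obtain ⟨φ, hφ, hφM, hlim⟩ := exists_contDiff_tendsto_ae (μ := μ) hg hM
  have hχm := hχ.1.continuous.measurable
  have hχa : ∀ p, |χ p| ≤ 1 := fun p => by rw [abs_of_nonneg (hχ0 p)]; exact hχ1 p
  have hψM : ∀ n p, |χ p * φ n p| ≤ M + 1 := fun n p => by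
    rw [abs_mul]
    exact (mul_le_of_le_one_left (abs_nonneg _) (hχa p)).trans (hφM n p)
  have key : Tendsto (fun n => ∫ p, (p.2 ^ 2 * χ p - p.2 ^ 2 * (χ p * φ n p) ^ 2 +
      χ p * φ n p * f p) ∂μ) atTop
      (𝓝 (∫ p, (p.2 ^ 2 * χ p - p.2 ^ 2 * g p ^ 2 + g p * f p) ∂μ)) := by
    refine tendsto_integral_of_dominated_convergence
      (fun p => K ^ 2 * (1 + (M + 1) ^ 2) + (M + 1) * |f p|) (fun n => ?_) ?_ (fun n => ?_) ?_
    · exact (integrable_dual hf hχm (hχm.mul (hφ n).continuous.measurable) hχa hK (hψM n)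
        fun p hp => by rw [Pi.mul_apply, hp, zero_mul]).1
    · exact (integrable_const _).add (hf.abs.const_mul _)
    · refine ae_of_all _ fun p => ?_
      rw [Real.norm_eq_abs]
      refine (abs_add_le _ _).trans (add_le_add ?_ ?_)
      · by_cases h : χ p = 0
        · rw [h]
          simp
          positivity
        · have h1 : p.2 ^ 2 ≤ K ^ 2 := sq_le_sq.2 ((hK p h).trans (le_abs_self K))
          rw [← mul_sub, abs_mul, abs_of_nonneg (sq_nonneg p.2)]
          refine mul_le_mul h1 ?_ (abs_nonneg _) (sq_nonneg K)
          refine (abs_sub _ _).trans (add_le_add (hχa p) ?_)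
          rw [abs_of_nonneg (sq_nonneg _)]
          exact sq_le_sq.2 ((hψM n p).trans (le_abs_self _))
      · rw [abs_mul]
        exact mul_le_mul_of_nonneg_right (hψM n p) (abs_nonneg _)
    · filter_upwards [hlim] with p hp
      have h1 : Tendsto (fun n => χ p * φ n p) atTop (𝓝 (g p)) := by
        have := hp.const_mul (χ p)
        rwa [hgχ p] at this
      exact (tendsto_const_nhds.sub ((h1.pow 2).const_mul _)).add (h1.mul_const _)
  refine le_of_tendsto (ENNReal.tendsto_ofReal key) (Eventually.of_forall fun n => ?_)
  refine h χ _ hχ ⟨hχ.1.mul (hφ n), hχ.2.1.mul_right, ?_⟩ hχ0 hχ1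
  exact (tsupport_mul_subset_left (f := χ)).trans hχ.2.2

/-- Truncation sets on which the minimiser of the dual problem is bounded. -/
def truncSet (f : ℝ × ℝ → ℝ) (n : ℕ) : Set (ℝ × ℝ) :=
  {p | 0 < p.1 ∧ p.1 ≤ 1 - 1 / ((n : ℝ) + 1) ∧ 1 / ((n : ℝ) + 1) ≤ |p.2| ∧ |p.2| ≤ n ∧ |f p| ≤ n}

lemma measurableSet_truncSet {f : ℝ × ℝ → ℝ} (hf : Measurable f) (n : ℕ) :
    MeasurableSet (truncSet f n) := by
  unfold truncSet
  refine (measurableSet_lt measurable_const measurable_fst).inter <|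
    (measurableSet_le measurable_fst measurable_const).inter <|
    (measurableSet_le measurable_const measurable_snd.abs).inter <|
    (measurableSet_le measurable_snd.abs measurable_const).inter
      (measurableSet_le hf.abs measurable_const)

lemma monotone_truncSet (f : ℝ × ℝ → ℝ) : Monotone (truncSet f) := by
  intro m n hmn p ⟨h1, h2, h3, h4, h5⟩
  have hmn' : (m : ℝ) ≤ n := by exact_mod_cast hmn
  have : 1 / ((n : ℝ) + 1) ≤ 1 / ((m : ℝ) + 1) :=
    one_div_le_one_div_of_le (by positivity) (by linarith)
  exact ⟨h1, by linarith, by linarith, by linarith, by linarith⟩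

lemma iUnion_truncSet (f : ℝ × ℝ → ℝ) :
    ⋃ n, truncSet f n = (Ioo (0 : ℝ) 1 ×ˢ (univ : Set ℝ)) ∩ {p | p.2 ≠ 0} := by
  ext p
  simp only [mem_iUnion, mem_inter_iff, mem_prod, mem_univ, and_true, mem_ofPred_eq]
  constructor
  · rintro ⟨n, h1, h2, h3, -⟩
    have hn : 0 < 1 / ((n : ℝ) + 1) := by positivity
    exact ⟨⟨h1, by linarith⟩, abs_pos.1 (by linarith)⟩
  · rintro ⟨⟨h1, h2⟩, h3⟩
    have t := tendsto_one_div_add_atTop_nhds_zero_nat (𝕜 := ℝ)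
    have e1 := t.eventually_le_const (sub_pos.2 h2)
    have e2 := t.eventually_le_const (abs_pos.2 h3)
    have e3 := (tendsto_natCast_atTop_atTop (R := ℝ)).eventually_ge_atTop |p.2|
    have e4 := (tendsto_natCast_atTop_atTop (R := ℝ)).eventually_ge_atTop |f p|
    obtain ⟨n, a1, a2, a3, a4⟩ := (e1.and (e2.and (e3.and e4))).exists
    exact ⟨n, h1, by linarith, a2, a3, a4⟩

lemma setLIntegral_truncSet_le {μ : Measure (ℝ × ℝ)} [IsFiniteMeasure μ] {f : ℝ × ℝ → ℝ}
    (hfm : Measurable f) (hf : Integrable f μ) {C : ℝ≥0∞}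
    (h : ∀ χ ψ, IsTest χ → IsTest ψ → (∀ p, 0 ≤ χ p) → (∀ p, χ p ≤ 1) →
      ENNReal.ofReal (∫ p, (p.2 ^ 2 * χ p - p.2 ^ 2 * ψ p ^ 2 + ψ p * f p) ∂μ) ≤ C) (n : ℕ) :
    ∫⁻ p in truncSet f n, ENNReal.ofReal (p.2 ^ 2 + 1 / (4 * p.2 ^ 2) * f p ^ 2) ∂μ ≤ C := by
  have hS := measurableSet_truncSet hfm n
  have hn1 : (0 : ℝ) < n + 1 := by positivity
  set χ : ℝ × ℝ → ℝ := fun p =>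
    plateau (-1) 1 (2 * (n + 1)) p.1 * plateau (-(n + 2)) (n + 2) 2 p.2 with hχd
  set g : ℝ × ℝ → ℝ := (truncSet f n).indicator fun p => f p / (2 * p.2 ^ 2) with hgd
  have hpl := isTest1D_plateau (α := -((n : ℝ) + 2)) (β := n + 2) (n := 2) two_pos
  have hχ : IsTest χ := isTest_mul (isTest1D_plateau (by positivity)) hpl.1 hpl.2.1
  have hχ0 : ∀ p, 0 ≤ χ p := fun p => mul_nonneg (plateau_nonneg _ _ _ _) (plateau_nonneg _ _ _ _)
  have hχ1 : ∀ p, χ p ≤ 1 := fun p =>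
    mul_le_one₀ (plateau_le_one _ _ _ _) (plateau_nonneg _ _ _ _) (plateau_le_one _ _ _ _)
  have hK : ∀ p, χ p ≠ 0 → |p.2| ≤ n + 2 := fun p hp => by
    have := hpl.2.2 (subset_tsupport _ (right_ne_zero_of_mul hp))
    exact abs_le.2 ⟨this.1.le, this.2.le⟩
  have hχS : ∀ p ∈ truncSet f n, χ p = 1 := by
    rintro p ⟨h1, h2, -, h4, -⟩
    have h2' : 1 ≤ (n + 1) * (1 - p.1) := by
      rw [mul_comm, ← div_le_iff₀ hn1]
      linarith
    have h4' := abs_le.1 h4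
    simp only [hχd]
    rw [plateau_eq_one (by nlinarith [Nat.cast_nonneg (α := ℝ) n]) (by nlinarith),
      plateau_eq_one (by linarith) (by linarith), one_mul]
  have hg : Measurable g := (hfm.div (by fun_prop)).indicator hS
  have hgχ : ∀ p, χ p * g p = g p := fun p => by
    by_cases hp : p ∈ truncSet f n
    · rw [hχS p hp, one_mul]
    · rw [hgd, indicator_of_notMem hp, mul_zero]
  have hM : ∀ p, |g p| ≤ n * (n + 1) ^ 2 := fun p => by
    by_cases hp : p ∈ truncSet f n
    · rw [hgd, indicator_of_mem hp]
      obtain ⟨-, -, h3, -, h5⟩ := hp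
      have hk : 0 < |p.2| := lt_of_lt_of_le (by positivity) h3
      have h3' : 1 ≤ (n + 1) * |p.2| := by rwa [div_le_iff₀' hn1] at h3
      have h6 : 1 ≤ (n + 1) ^ 2 * p.2 ^ 2 := by
        rw [← sq_abs p.2, ← mul_pow]
        exact one_le_pow₀ h3'
      rw [← sq_abs p.2, abs_div, abs_of_pos (a := 2 * |p.2| ^ 2) (by positivity),
        div_le_iff₀ (by positivity), sq_abs]
      nlinarith [Nat.cast_nonneg (α := ℝ) n]
    · rw [hgd, indicator_of_notMem hp, abs_zero]
      positivity
  refine le_trans ?_ (ofReal_integral_dual_le hf h hχ hχ0 hχ1 hg hK hM hgχ)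
  have hχa : ∀ p, |χ p| ≤ 1 := fun p => by rw [abs_of_nonneg (hχ0 p)]; exact hχ1 p
  have hi := integrable_dual hf hχ.1.continuous.measurable hg hχa hK hM
    fun p hp => by rw [← hgχ p, hp, zero_mul]
  have e : ∀ p ∈ truncSet f n, p.2 ^ 2 * χ p - p.2 ^ 2 * g p ^ 2 + g p * f p =
      p.2 ^ 2 + 1 / (4 * p.2 ^ 2) * f p ^ 2 := fun p hp => by
    have hk : p.2 ≠ 0 := abs_pos.1 (lt_of_lt_of_le (by positivity) hp.2.2.1)
    rw [hχS p hp, hgd, indicator_of_mem hp]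
    field_simp
    ring
  have e0 : ∀ p ∉ truncSet f n, 0 ≤ p.2 ^ 2 * χ p - p.2 ^ 2 * g p ^ 2 + g p * f p :=
    fun p hp => by
      rw [hgd, indicator_of_notMem hp]
      simpa using mul_nonneg (sq_nonneg p.2) (hχ0 p)
  have hnn : ∀ p, 0 ≤ p.2 ^ 2 * χ p - p.2 ^ 2 * g p ^ 2 + g p * f p := fun p => by
    by_cases hp : p ∈ truncSet f n
    · rw [e p hp]
      positivity
    · exact e0 p hp
  rw [ofReal_integral_eq_lintegral_ofReal hi (ae_of_all _ hnn)]
  refine le_trans (le_of_eq ?_) (setLIntegral_le_lintegral (truncSet f n) _)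
  exact setLIntegral_congr_fun hS fun p hp => by rw [e p hp]

lemma setLIntegral_dual_le {μ : Measure (ℝ × ℝ)} [IsFiniteMeasure μ] {f : ℝ × ℝ → ℝ}
    (hfm : Measurable f) (hf : Integrable f μ) {C : ℝ≥0∞}
    (h : ∀ χ ψ, IsTest χ → IsTest ψ → (∀ p, 0 ≤ χ p) → (∀ p, χ p ≤ 1) →
      ENNReal.ofReal (∫ p, (p.2 ^ 2 * χ p - p.2 ^ 2 * ψ p ^ 2 + ψ p * f p) ∂μ) ≤ C) :
    ∫⁻ p in Ioo (0 : ℝ) 1 ×ˢ (univ : Set ℝ),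
      ENNReal.ofReal (p.2 ^ 2 + 1 / (4 * p.2 ^ 2) * f p ^ 2) ∂μ ≤ C := by
  have hk : MeasurableSet {p : ℝ × ℝ | p.2 ≠ 0} :=
    (measurableSet_eq_fun measurable_snd measurable_const).compl
  have e : ∫⁻ p in Ioo (0 : ℝ) 1 ×ˢ (univ : Set ℝ),
      ENNReal.ofReal (p.2 ^ 2 + 1 / (4 * p.2 ^ 2) * f p ^ 2) ∂μ =
      ∫⁻ p in ⋃ n, truncSet f n, ENNReal.ofReal (p.2 ^ 2 + 1 / (4 * p.2 ^ 2) * f p ^ 2) ∂μ := by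
    rw [iUnion_truncSet, inter_comm, ← setLIntegral_indicator hk]
    congr 1
    ext p
    by_cases hp : p.2 = 0
    · simp [hp]
    · rw [indicator_of_mem (show p ∈ {p : ℝ × ℝ | p.2 ≠ 0} from hp)]
  rw [e, setLIntegral_iUnion_of_directed _ (monotone_truncSet f).directed_le]
  exact iSup_le (setLIntegral_truncSet_le hfm hf h)

/-- Integration against an absolutely continuous signed measure, through its density. -/
lemma sInt_eq_integral_rnDeriv {μ : Measure (ℝ × ℝ)} [IsFiniteMeasure μ]
    {s : SignedMeasure (ℝ × ℝ)} (hs : s.totalVariation ≪ μ) {ψ : ℝ × ℝ → ℝ} (hψ : Continuous ψ)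
    {D : ℝ} (hD : ∀ p, |ψ p| ≤ D) :
    sInt s ψ = ∫ p, ψ p * s.rnDeriv μ p ∂μ := by
  have hp : s.toJordanDecomposition.posPart ≪ μ :=
    (Measure.absolutelyContinuous_of_le (Measure.le_add_right le_rfl)).trans hs
  have hn : s.toJordanDecomposition.negPart ≪ μ :=
    (Measure.absolutelyContinuous_of_le (Measure.le_add_left le_rfl)).trans hs
  have i1 : Integrable (fun p => (s.toJordanDecomposition.posPart.rnDeriv μ p).toReal * ψ p) μ :=
    Measure.integrable_toReal_rnDeriv.mul_bdd (c := D) hψ.aestronglyMeasurable (ae_of_all _ hD)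
  have i2 : Integrable (fun p => (s.toJordanDecomposition.negPart.rnDeriv μ p).toReal * ψ p) μ :=
    Measure.integrable_toReal_rnDeriv.mul_bdd (c := D) hψ.aestronglyMeasurable (ae_of_all _ hD)
  have e1 := integral_rnDeriv_smul hp (f := ψ)
  have e2 := integral_rnDeriv_smul hn (f := ψ)
  simp only [smul_eq_mul] at e1 e2
  rw [sInt, ← e1, ← e2, ← integral_sub i1 i2]
  congr 1
  ext p
  rw [SignedMeasure.rnDeriv]
  ring

/-- **Lower bound (Γ-liminf inequality).** If `(w^L, u^L) ∈ A_L^in × A_L^out` converges to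
`μ ∈ M_∞`, then `liminf_{L→∞} F_L(w^L,u^L) ≥ F_∞(μ)`. -/
theorem lower_bound
    (W : ℝ → InData) (U : ℝ → OutData)
    (hmem : ∀ L > 0, MemALin L (W L) ∧ MemALout L (U L))
    (P : MeasPair) (hP : MemMInfty P)
    (hconv : ConvTo atTop id (fun L => (U L).u) P) :
    Finfty P ≤ Filter.liminf (fun L => ENNReal.ofReal (FL L (W L) (U L))) atTop := by
  have := hP.1
  have hP4 := hP.2.2.2.1
  refine setLIntegral_dual_le (SignedMeasure.measurable_rnDeriv _ _)
    (SignedMeasure.integrable_rnDeriv _ _) fun χ ψ hχ hψ _ hχ1 => ?_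
  set θ := dualDensity χ ψ with hθ
  have hθc := continuous_dualDensity hχ hψ
  have hθs := hasCompactSupport_dualDensity hχ hψ
  have hθi : Integrable θ P.mu := hθc.integrable_of_hasCompactSupport hθs
  have e : ∫ p, (p.2 ^ 2 * χ p - p.2 ^ 2 * ψ p ^ 2 + ψ p * P.mux.rnDeriv P.mu p) ∂P.mu =
      ∫ p, θ p ∂P.mu := by
    obtain ⟨D, hD⟩ := hψ.2.1.exists_bound_of_continuous hψ.1.continuous
    have h1 := sInt_eq_integral_rnDeriv hP.2.2.2.2.1 hψ.1.continuous hD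
    rw [hP4 ψ hψ] at h1
    have i1 : Integrable (fun p => dX ψ p) P.mu :=
      (continuous_dX hψ).integrable_of_hasCompactSupport (hψ.fderiv_apply (1, 0)).2.1
    have i2 : Integrable (fun p => p.2 ^ 2 * χ p - p.2 ^ 2 * ψ p ^ 2) P.mu :=
      (hθi.add i1).congr (ae_of_all _ fun p => by simp [hθ, dualDensity])
    have i3 : Integrable (fun p => ψ p * P.mux.rnDeriv P.mu p) P.mu :=
      (SignedMeasure.integrable_rnDeriv _ _).bdd_mul (c := D) hψ.1.continuous.aestronglyMeasurable
        (ae_of_all _ hD)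
    rw [integral_add i2 i3, ← h1, ← sub_eq_add_neg, ← integral_sub i2 i1]
    rfl
  rw [e]
  have hlim := (hconv θ hθc hθs).1
  rw [← (ENNReal.tendsto_ofReal hlim).liminf_eq]
  refine liminf_le_liminf ?_
  have hlarge : ∀ᶠ L : ℝ in atTop, ∫ p, θ p ∂P.mu + 1 ≤ L ^ 2 * (5 / 3) :=
    ((tendsto_pow_atTop two_ne_zero).atTop_mul_const (by norm_num)).eventually_ge_atTop _
  filter_upwards [hlarge, hlim.eventually_le_const (lt_add_one _), eventually_gt_atTop 0] with
    L h1 h2 hL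
  obtain ⟨hw, hu⟩ := hmem L hL
  refine ENNReal.ofReal_le_ofReal ?_
  rcases FL_lower_bound hL hw hu with h | h
  · rw [h]
    exact h2.trans h1
  · exact (muLpair_dualDensity_le hL hu hχ hψ hχ1).trans h
end
end

section
/- (Disintegration of μ ∈ M_∞ in the x-variable) Let μ ∈ M_∞. Then there exists a Lebesgue-measurable map x ↦ ν_x ∈ M_b^+(ℝ) such that (ν_x, 2x)_{x∈(0,1)} is a disintegration of μ in the x-variable. -/
open MeasureTheory Set Filter Topology
open scoped ENNReal

noncomputable section

/-- Finite measures on `ℝ` with the same integrals of test functions supported in `I` give the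
same mass to every open interval contained in `I`. -/
theorem measure_Ioo_eq_of_integral_test_eq {I : Set ℝ} {μ ν : Measure ℝ} [IsFiniteMeasure μ]
    [IsFiniteMeasure ν] (h : ∀ φ : ℝ → ℝ, IsTest1D I φ → ∫ x, φ x ∂μ = ∫ x, φ x ∂ν)
    {a b : ℝ} (hab : Ioo a b ⊆ I) : μ (Ioo a b) = ν (Ioo a b) := by
  rcases le_or_gt b a with hba | hba
  · simp [Ioo_eq_empty_of_le hba]
  obtain ⟨r, hr, c, rfl, rfl⟩ : ∃ r : ℝ, 0 < r ∧ ∃ c : ℝ, a = c - r ∧ b = c + r :=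
    ⟨(b - a) / 2, by linarith, (a + b) / 2, by ring, by ring⟩
  rw [← Real.ball_eq_Ioo] at hab ⊢
  let f : ℕ → ContDiffBump c := fun n =>
    { rIn := r * ((n + 1) / (n + 3))
      rOut := r * ((n + 2) / (n + 3))
      rIn_pos := by positivity
      rIn_lt_rOut := by gcongr; norm_num }
  have hout (n : ℕ) : (f n).rOut < r := by
    refine mul_lt_of_lt_one_right hr ((div_lt_one (by positivity)).2 (by linarith))
  have hin : Tendsto (fun n => (f n).rIn) atTop (𝓝 r) := by
    have hlim : Tendsto (fun n : ℕ => r * (((n + 1 : ℕ) : ℝ) / ((n + 1 : ℕ) + (2 : ℝ)))) atTop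
        (𝓝 (r * 1)) :=
      ((tendsto_natCast_div_add_atTop (2 : ℝ)).comp (tendsto_add_atTop_nat 1)).const_mul r
    rw [mul_one] at hlim
    refine hlim.congr fun n => ?_
    simp only [f]
    push_cast
    ring_nf
  have hptw (x : ℝ) : Tendsto (fun n => f n x) atTop
      (𝓝 ((Metric.ball c r).indicator (fun _ => (1 : ℝ)) x)) := by
    by_cases hx : x ∈ Metric.ball c r
    · rw [indicator_of_mem hx]
      refine tendsto_const_nhds.congr' ?_
      filter_upwards [hin.eventually (lt_mem_nhds (Metric.mem_ball.1 hx))] with n hn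
      exact ((f n).one_of_mem_closedBall hn.le).symm
    · rw [indicator_of_notMem hx]
      refine tendsto_const_nhds.congr fun n => ((f n).zero_of_le_dist ?_).symm
      exact (hout n).le.trans (not_lt.1 hx)
  have hint (κ : Measure ℝ) [IsFiniteMeasure κ] :
      Tendsto (fun n => ∫ x, f n x ∂κ) atTop (𝓝 (κ.real (Metric.ball c r))) := by
    rw [← integral_indicator_one Metric.isOpen_ball.measurableSet]
    refine tendsto_integral_of_dominated_convergence (fun _ => 1)
      (fun n => (f n).continuous.aestronglyMeasurable) (integrable_const 1)
      (fun n => ae_of_all _ fun x => ?_) (ae_of_all _ hptw)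
    rw [Real.norm_of_nonneg (f n).nonneg]
    exact (f n).le_one
  have htest (n : ℕ) : IsTest1D I (f n) :=
    ⟨(f n).contDiff, (f n).hasCompactSupport, by
      rw [(f n).tsupport_eq]
      exact (Metric.closedBall_subset_ball (hout n)).trans hab⟩
  have hreal := tendsto_nhds_unique (hint μ) ((hint ν).congr fun n => (h _ (htest n)).symm)
  exact (measureReal_eq_measureReal_iff).1 hreal

/-- Finite measures concentrated on an open interval are determined by their integrals of test
functions supported in that interval. -/
theorem measure_eq_of_integral_test_eq {s t : ℝ} {μ ν : Measure ℝ} [IsFiniteMeasure μ]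
    [IsFiniteMeasure ν] (hμ : μ (Ioo s t)ᶜ = 0) (hν : ν (Ioo s t)ᶜ = 0)
    (h : ∀ φ : ℝ → ℝ, IsTest1D (Ioo s t) φ → ∫ x, φ x ∂μ = ∫ x, φ x ∂ν) : μ = ν := by
  refine Real.measure_ext_Ioo_rat fun p q => ?_
  rw [← measure_inter_conull hμ, ← measure_inter_conull hν, Ioo_inter_Ioo]
  exact measure_Ioo_eq_of_integral_test_eq h
    (Ioo_subset_Ioo le_sup_right inf_le_right)

/-- The measure `2x dx` on `(0,1)`. -/
def twoMulMeasure : Measure ℝ :=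
  (volume.restrict (Ioo (0 : ℝ) 1)).withDensity fun x => ENNReal.ofReal (2 * x)

theorem integrableOn_two_mul : IntegrableOn (fun x : ℝ => 2 * x) (Ioo (0 : ℝ) 1) :=
  (Continuous.integrableOn_Icc (by fun_prop)).mono_set Ioo_subset_Icc_self

instance : IsFiniteMeasure twoMulMeasure :=
  isFiniteMeasure_withDensity_ofReal integrableOn_two_mul.2

theorem integral_twoMulMeasure (g : ℝ → ℝ) :
    ∫ x, g x ∂twoMulMeasure = ∫ x in Ioo (0 : ℝ) 1, g x * (2 * x) := by
  rw [twoMulMeasure, integral_withDensity_eq_integral_toReal_smul (by fun_prop)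
    (ae_of_all _ fun _ => ENNReal.ofReal_lt_top)]
  refine setIntegral_congr_fun measurableSet_Ioo fun x hx => ?_
  have : 0 ≤ 2 * x := by linarith [hx.1]
  simp only [ENNReal.toReal_ofReal this, smul_eq_mul]
  ring

/-- The constraint in `M_∞` says that the `x`-marginal of `μ` on `(0,1)` is `2x dx`. -/
theorem MemMInfty.fst_restrict_eq {P : MeasPair} (hP : MemMInfty P) :
    (P.mu.restrict (Ioo (0 : ℝ) 1 ×ˢ (univ : Set ℝ))).fst = twoMulMeasure := by
  obtain ⟨_, -, -, -, -, hconstr⟩ := hP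
  refine measure_eq_of_integral_test_eq (s := 0) (t := 1) ?_ ?_ fun φ hφ => ?_
  · rw [Measure.fst_apply measurableSet_Ioo.compl,
      Measure.restrict_apply (measurable_fst measurableSet_Ioo.compl)]
    convert measure_empty (μ := P.mu)
    ext p
    simp
  · exact withDensity_absolutelyContinuous _ _ (by
      rw [Measure.restrict_apply measurableSet_Ioo.compl, compl_inter_self, measure_empty])
  · rw [Measure.fst, integral_map measurable_fst.aemeasurable
      hφ.1.continuous.aestronglyMeasurable, hconstr φ hφ, integral_twoMulMeasure]
    simp only [mul_comm]

/-- **Disintegration of `μ ∈ M_∞` in the `x`-variable.** Every `μ ∈ M_∞` admits a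
disintegration of the form `(ν_x, 2x)_{x ∈ (0,1)}`. -/
theorem disintegration_MInfty (P : MeasPair) (hP : MemMInfty P) :
    ∃ ν : ℝ → Measure ℝ,
      IsDisintegrationX (Ioo (0 : ℝ) 1) P.mu ν (fun x => 2 * x) := by
  have hfst := hP.fst_restrict_eq
  have := hP.1
  let ρ := P.mu.restrict (Ioo (0 : ℝ) 1 ×ˢ (univ : Set ℝ))
  refine ⟨fun x => ρ.condKernel x, fun s hs => ρ.condKernel.measurable_coe hs,
    fun x _ => measure_univ, integrableOn_two_mul, fun f hf => ?_⟩
  rw [← Measure.integral_condKernel hf.restrict, hfst, integral_twoMulMeasure]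
end
end

section
/- (Dilation of μ) Let μ ∈ M_∞. Then for each λ ∈ (1,2) there exists μ_λ ∈ M_∞^λ such that: (μ_λ, μ_{λ,x})⌐((0,1)×ℝ) converges weakly-* to (μ, μ_{,x}) as λ ↓ 1; ∫_{(0,λ)×ℝ} k² dμ_λ = λ² ∫_{(0,1)×ℝ} k² dμ; ∫_{(0,λ)×ℝ} (1/(4k²))(dμ_{λ,x}/dμ_λ)² dμ_λ = ∫_{(0,1)×ℝ} (1/(4k²))(dμ_{,x}/dμ)² dμ; in particular lim_{λ↓1} F_∞^λ(μ_λ) = F_∞(μ). Moreover (ν_{x/λ}, 2x)_{x∈(0,λ)} is a disintegration of μ_λ in the x-variable, where (ν_x, 2x)_{x∈(0,1)} is the disintegration of μ. -/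
open MeasureTheory Set Filter Topology
open scoped ENNReal

noncomputable section

/-- The dilation `(x, k) ↦ (c x, k)` of the plane in the first variable. -/
def dilate (c : ℝ) (p : ℝ × ℝ) : ℝ × ℝ := (c * p.1, p.2)

/-- The dilation of a pair `(μ, μ_{,x})`, scaled so that the constraint `2x dx` is preserved. -/
def dilatePair (c : NNReal) (P : MeasPair) : MeasPair :=
  ⟨c ^ 2 • P.mu.map (dilate c), c • P.mux.map (dilate c)⟩

lemma contDiff_dilate (c : ℝ) : ContDiff ℝ (⊤ : ℕ∞) (dilate c) := by
  unfold dilate; fun_prop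

lemma continuous_dilate (c : ℝ) : Continuous (dilate c) :=
  (contDiff_dilate c).continuous

lemma injective_dilate {c : ℝ} (hc : c ≠ 0) : Function.Injective (dilate c) := by
  rintro ⟨a, b⟩ ⟨a', b'⟩ h
  simpa [dilate, hc] using h

lemma measurableEmbedding_dilate {c : ℝ} (hc : c ≠ 0) : MeasurableEmbedding (dilate c) :=
  (continuous_dilate c).measurableEmbedding (injective_dilate hc)

lemma dilate_inv_dilate {c : ℝ} (hc : c ≠ 0) (p : ℝ × ℝ) : dilate c⁻¹ (dilate c p) = p := by
  simp [dilate, hc]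

lemma preimage_dilate_strip {c : ℝ} (hc : 0 < c) :
    dilate c ⁻¹' (Ioo (0 : ℝ) c ×ˢ (univ : Set ℝ)) = Ioo (0 : ℝ) 1 ×ˢ (univ : Set ℝ) := by
  ext p
  simp only [dilate, mem_preimage, mem_prod, mem_Ioo, mem_univ, and_true]
  rw [mul_pos_iff_of_pos_left hc, mul_lt_iff_lt_one_right hc]

lemma hasCompactSupport_comp_dilate {c : ℝ} (hc : c ≠ 0) {φ : ℝ × ℝ → ℝ}
    (hφ : HasCompactSupport φ) : HasCompactSupport (φ ∘ dilate c) := by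
  refine HasCompactSupport.of_support_subset_isCompact
    (hφ.isCompact.image (continuous_dilate c⁻¹)) fun p hp => ?_
  exact ⟨dilate c p, subset_tsupport φ hp, dilate_inv_dilate hc p⟩

lemma tsupport_comp_dilate_subset (c : ℝ) (φ : ℝ × ℝ → ℝ) :
    tsupport (φ ∘ dilate c) ⊆ dilate c ⁻¹' tsupport φ :=
  closure_minimal (fun _ hp => subset_tsupport φ hp)
    ((isClosed_tsupport φ).preimage (continuous_dilate c))

lemma IsTest2D.isTest_comp_dilate {c : ℝ} (hc : 0 < c) {φ : ℝ × ℝ → ℝ}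
    (hφ : IsTest2D (Ioo (0 : ℝ) c ×ˢ (univ : Set ℝ)) φ) : IsTest (φ ∘ dilate c) := by
  refine ⟨hφ.1.comp (contDiff_dilate c), hasCompactSupport_comp_dilate hc.ne' hφ.2.1, ?_⟩
  refine (tsupport_comp_dilate_subset c φ).trans ((preimage_mono hφ.2.2).trans ?_)
  rw [preimage_dilate_strip hc]
  exact prod_mono (Ioo_subset_Ioo_left (by norm_num)) Subset.rfl

lemma IsTest1D.comp_mul_left {c : ℝ} (hc : 0 < c) {φ : ℝ → ℝ}
    (hφ : IsTest1D (Ioo (0 : ℝ) c) φ) : IsTest1D (Ioo (0 : ℝ) 1) fun x => φ (c * x) := by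
  refine ⟨hφ.1.comp (by fun_prop), ?_, fun x hx => ?_⟩
  · refine HasCompactSupport.of_support_subset_isCompact
      (hφ.2.1.isCompact.image (continuous_const_mul c⁻¹)) fun x hx => ?_
    exact ⟨c * x, subset_tsupport φ hx, by field_simp⟩
  · have hx' : c * x ∈ tsupport φ :=
      closure_minimal (s := Function.support fun x => φ (c * x))
        (t := (fun x => c * x) ⁻¹' tsupport φ) (fun _ hp => subset_tsupport φ hp)
        ((isClosed_tsupport φ).preimage (continuous_const_mul c)) hx
    have := hφ.2.2 hx'
    rwa [mem_Ioo, mul_pos_iff_of_pos_left hc, mul_lt_iff_lt_one_right hc] at this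

lemma dX_comp_dilate (c : ℝ) {φ : ℝ × ℝ → ℝ} (hφ : Differentiable ℝ φ) (p : ℝ × ℝ) :
    dX (φ ∘ dilate c) p = c * dX φ (dilate c p) := by
  have h : HasFDerivAt (dilate c)
      ((c • ContinuousLinearMap.fst ℝ ℝ ℝ).prod (ContinuousLinearMap.snd ℝ ℝ ℝ)) p :=
    (hasFDerivAt_fst.const_mul c).prodMk hasFDerivAt_snd
  have h1 : ((c • ContinuousLinearMap.fst ℝ ℝ ℝ).prod (ContinuousLinearMap.snd ℝ ℝ ℝ))
      ((1 : ℝ), (0 : ℝ)) = c • ((1 : ℝ), (0 : ℝ)) := by simp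
  rw [dX, ((hφ _).hasFDerivAt.comp p h).fderiv, ContinuousLinearMap.comp_apply, h1, map_smul,
    smul_eq_mul, dX]

lemma setIntegral_Ioo_comp_mul_left {c : ℝ} (hc : 0 < c) (g : ℝ → ℝ) :
    ∫ x in Ioo (0 : ℝ) c, g x = c * ∫ x in Ioo (0 : ℝ) 1, g (c * x) := by
  rw [← integral_Ioc_eq_integral_Ioo, ← integral_Ioc_eq_integral_Ioo,
    ← intervalIntegral.integral_of_le hc.le, ← intervalIntegral.integral_of_le zero_le_one,
    ← smul_eq_mul, intervalIntegral.smul_integral_comp_mul_left]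
  simp

/-- The image of a Jordan decomposition under a measurable embedding. -/
def MeasureTheory.JordanDecomposition.mapEmbedding {α β : Type*} [MeasurableSpace α]
    [MeasurableSpace β] (j : JordanDecomposition α) {f : α → β} (hf : MeasurableEmbedding f) :
    JordanDecomposition β where
  posPart := j.posPart.map f
  negPart := j.negPart.map f
  mutuallySingular := by
    obtain ⟨s, hs, h1, h2⟩ := j.mutuallySingular
    refine ⟨f '' s, hf.measurableSet_image.2 hs, ?_, ?_⟩
    · rwa [hf.map_apply, hf.injective.preimage_image]
    · rwa [hf.map_apply, preimage_compl, hf.injective.preimage_image]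

lemma toJordanDecomposition_map {α β : Type*} [MeasurableSpace α] [MeasurableSpace β]
    (s : SignedMeasure α) {f : α → β} (hf : MeasurableEmbedding f) :
    SignedMeasure.toJordanDecomposition (s.map f) = s.toJordanDecomposition.mapEmbedding hf := by
  refine SignedMeasure.toJordanDecomposition_eq ?_
  ext i hi
  rw [VectorMeasure.map_apply _ hf.measurable hi, JordanDecomposition.toSignedMeasure,
    Measure.toSignedMeasure_sub_apply hi]
  conv_lhs => rw [← s.toSignedMeasure_toJordanDecomposition,
    JordanDecomposition.toSignedMeasure, Measure.toSignedMeasure_sub_apply (hf.measurable hi)]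
  simp [JordanDecomposition.mapEmbedding, measureReal_def, hf.map_apply]

lemma posPart_dilatePair {c : NNReal} (hc : c ≠ 0) (P : MeasPair) :
    (dilatePair c P).mux.toJordanDecomposition.posPart =
      c • P.mux.toJordanDecomposition.posPart.map (dilate c) := by
  rw [dilatePair, SignedMeasure.toJordanDecomposition_smul,
    toJordanDecomposition_map _ (measurableEmbedding_dilate (NNReal.coe_ne_zero.2 hc))]
  rfl

lemma negPart_dilatePair {c : NNReal} (hc : c ≠ 0) (P : MeasPair) :
    (dilatePair c P).mux.toJordanDecomposition.negPart =
      c • P.mux.toJordanDecomposition.negPart.map (dilate c) := by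
  rw [dilatePair, SignedMeasure.toJordanDecomposition_smul,
    toJordanDecomposition_map _ (measurableEmbedding_dilate (NNReal.coe_ne_zero.2 hc))]
  rfl

lemma totalVariation_dilatePair {c : NNReal} (hc : c ≠ 0) (P : MeasPair) :
    (dilatePair c P).mux.totalVariation = c • P.mux.totalVariation.map (dilate c) := by
  rw [SignedMeasure.totalVariation, SignedMeasure.totalVariation, posPart_dilatePair hc,
    negPart_dilatePair hc, Measure.map_add _ _ (continuous_dilate _).measurable, smul_add]

lemma setIntegral_dilatePair {c : NNReal} (hc : c ≠ 0) (P : MeasPair) (s : Set (ℝ × ℝ))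
    (f : ℝ × ℝ → ℝ) :
    ∫ p in s, f p ∂(dilatePair c P).mu =
      c ^ 2 * ∫ p in dilate c ⁻¹' s, f (dilate c p) ∂P.mu := by
  rw [dilatePair, Measure.restrict_smul, integral_smul_nnreal_measure,
    (measurableEmbedding_dilate (NNReal.coe_ne_zero.2 hc)).setIntegral_map]
  simp [NNReal.smul_def]

lemma integral_dilatePair {c : NNReal} (hc : c ≠ 0) (P : MeasPair) (f : ℝ × ℝ → ℝ) :
    ∫ p, f p ∂(dilatePair c P).mu = c ^ 2 * ∫ p, f (dilate c p) ∂P.mu := by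
  simpa using setIntegral_dilatePair hc P univ f

lemma sIntOn_dilatePair {c : NNReal} (hc : c ≠ 0) (P : MeasPair) (s : Set (ℝ × ℝ))
    (f : ℝ × ℝ → ℝ) :
    sIntOn (dilatePair c P).mux s f =
      c * sIntOn P.mux (dilate c ⁻¹' s) (f ∘ dilate c) := by
  rw [sIntOn, sIntOn, posPart_dilatePair hc, negPart_dilatePair hc, Measure.restrict_smul,
    Measure.restrict_smul, integral_smul_nnreal_measure, integral_smul_nnreal_measure,
    (measurableEmbedding_dilate (NNReal.coe_ne_zero.2 hc)).setIntegral_map,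
    (measurableEmbedding_dilate (NNReal.coe_ne_zero.2 hc)).setIntegral_map, mul_sub]
  rfl

lemma sInt_dilatePair {c : NNReal} (hc : c ≠ 0) (P : MeasPair) (f : ℝ × ℝ → ℝ) :
    sInt (dilatePair c P).mux f = c * sInt P.mux (f ∘ dilate c) := by
  simpa [sIntOn, sInt] using sIntOn_dilatePair hc P univ f

lemma setLIntegral_dilatePair {c : NNReal} (hc : c ≠ 0) (P : MeasPair) (f : ℝ × ℝ → ℝ≥0∞) :
    ∫⁻ p in Ioo (0 : ℝ) c ×ˢ (univ : Set ℝ), f p ∂(dilatePair c P).mu =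
      c ^ 2 * ∫⁻ p in Ioo (0 : ℝ) 1 ×ˢ (univ : Set ℝ), f (dilate c p) ∂P.mu := by
  have he := measurableEmbedding_dilate (NNReal.coe_ne_zero.2 hc)
  rw [dilatePair, Measure.restrict_smul, lintegral_smul_measure, he.restrict_map,
    he.lintegral_map, preimage_dilate_strip (by positivity)]
  simp [ENNReal.smul_def]

lemma rnDeriv_dilatePair {c : NNReal} (hc : c ≠ 0) (P : MeasPair) [IsFiniteMeasure P.mu] :
    (fun p => (dilatePair c P).mux.rnDeriv (dilatePair c P).mu (dilate c p)) =ᵐ[P.mu]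
      fun p => (c : ℝ)⁻¹ * P.mux.rnDeriv P.mu p := by
  have he := measurableEmbedding_dilate (NNReal.coe_ne_zero.2 hc)
  have key : ∀ ρ : Measure (ℝ × ℝ), IsFiniteMeasure ρ →
      (fun p => ((c • ρ.map (dilate c)).rnDeriv (c ^ 2 • P.mu.map (dilate c))
        (dilate c p)).toReal) =ᵐ[P.mu] fun p => (c : ℝ)⁻¹ * (ρ.rnDeriv P.mu p).toReal := by
    intro ρ _
    have h1 := Measure.rnDeriv_smul_right (c • ρ.map (dilate c)) (P.mu.map (dilate c))
      (pow_ne_zero 2 hc)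
    have h2 := Measure.rnDeriv_smul_left (ρ.map (dilate c)) (P.mu.map (dilate c)) c
    have h3 := ae_of_ae_map he.measurable.aemeasurable (h1.and h2)
    filter_upwards [h3, he.rnDeriv_map ρ P.mu] with p hp hp'
    rw [hp.1, Pi.smul_apply, hp.2, Pi.smul_apply, hp', smul_smul, ENNReal.smul_def, smul_eq_mul,
      ENNReal.toReal_mul, ENNReal.coe_toReal]
    have : (c : ℝ) ≠ 0 := NNReal.coe_ne_zero.2 hc
    congr 1
    push_cast
    field_simp
  filter_upwards [key P.mux.toJordanDecomposition.posPart inferInstance,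
    key P.mux.toJordanDecomposition.negPart inferInstance] with p hp hp'
  rw [SignedMeasure.rnDeriv, SignedMeasure.rnDeriv, posPart_dilatePair hc, negPart_dilatePair hc,
    mul_sub, ← hp, ← hp']
  rfl

lemma MemMInfty.measure_compl_eq_zero {P : MeasPair} (hP : MemMInfty P) :
    P.mu (Ioo (0 : ℝ) 1 ×ˢ (univ : Set ℝ))ᶜ = 0 := by
  refine measure_mono_null (fun p hp => ?_) (measure_union_null hP.2.1 hP.2.2.1)
  simp only [Strip, mem_union, mem_compl_iff, mem_prod, mem_Ioo, mem_Ioc, mem_univ,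
    and_true] at hp ⊢
  by_contra! h
  exact hp ⟨h.2 h.1.1, h.1.2⟩

lemma memMInftyLam_dilatePair {c : NNReal} (hc : c ≠ 0) {P : MeasPair} (hP : MemMInfty P) :
    MemMInftyLam c (dilatePair c P) := by
  have hc' : (0 : ℝ) < c := by positivity
  have he := measurableEmbedding_dilate hc'.ne'
  have := hP.1
  refine ⟨?_, ?_, fun φ hφ => ?_, ?_, fun φ hφ => ?_⟩
  · rw [dilatePair]; infer_instance
  · rw [dilatePair, Measure.smul_apply, he.map_apply, preimage_compl,
      preimage_dilate_strip hc', hP.measure_compl_eq_zero, smul_zero]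
  · rw [sInt_dilatePair hc, integral_dilatePair hc, hP.2.2.2.1 _ (hφ.isTest_comp_dilate hc')]
    simp_rw [dX_comp_dilate (c : ℝ) (hφ.1.differentiable (by simp))]
    rw [integral_const_mul]
    ring
  · rw [totalVariation_dilatePair hc]
    exact ((hP.2.2.2.2.1.map he.measurable).smul_left c).trans
      (Measure.absolutelyContinuous_smul (ENNReal.coe_ne_zero.2 (pow_ne_zero 2 hc)))
  · rw [setIntegral_dilatePair hc, preimage_dilate_strip hc', setIntegral_Ioo_comp_mul_left hc']
    simp only [dilate]
    rw [hP.2.2.2.2.2 _ (hφ.comp_mul_left hc'), ← integral_const_mul, ← integral_const_mul]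
    congr 1 with x
    ring

lemma lintegral_sq_dilatePair {c : NNReal} (hc : c ≠ 0) (P : MeasPair) :
    ∫⁻ p in Ioo (0 : ℝ) c ×ˢ (univ : Set ℝ), ENNReal.ofReal (p.2 ^ 2) ∂(dilatePair c P).mu =
      c ^ 2 * ∫⁻ p in Ioo (0 : ℝ) 1 ×ˢ (univ : Set ℝ), ENNReal.ofReal (p.2 ^ 2) ∂P.mu :=
  setLIntegral_dilatePair hc P _

lemma lintegral_rnDeriv_sq_dilatePair {c : NNReal} (hc : c ≠ 0) (P : MeasPair)
    [IsFiniteMeasure P.mu] :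
    ∫⁻ p in Ioo (0 : ℝ) c ×ˢ (univ : Set ℝ), ENNReal.ofReal (1 / (4 * p.2 ^ 2) *
        ((dilatePair c P).mux.rnDeriv (dilatePair c P).mu p) ^ 2) ∂(dilatePair c P).mu =
      ∫⁻ p in Ioo (0 : ℝ) 1 ×ˢ (univ : Set ℝ),
        ENNReal.ofReal (1 / (4 * p.2 ^ 2) * (P.mux.rnDeriv P.mu p) ^ 2) ∂P.mu := by
  have hc' : (c : ℝ) ≠ 0 := NNReal.coe_ne_zero.2 hc
  rw [setLIntegral_dilatePair hc, ← lintegral_const_mul' _ _ (by simp)]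
  refine lintegral_congr_ae ?_
  filter_upwards [ae_restrict_of_ae (rnDeriv_dilatePair hc P)] with p hp
  rw [hp, ← ENNReal.ofReal_coe_nnreal, ← ENNReal.ofReal_pow (by positivity),
    ← ENNReal.ofReal_mul (by positivity)]
  congr 1
  simp only [dilate]
  rw [mul_pow, inv_pow, mul_left_comm, mul_inv_cancel_left₀ (pow_ne_zero 2 hc')]

lemma FinftyLam_eq_add (lam : ℝ) (P : MeasPair) :
    FinftyLam lam P =
      (∫⁻ p in Ioo (0 : ℝ) lam ×ˢ (univ : Set ℝ), ENNReal.ofReal (p.2 ^ 2) ∂P.mu) +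
      ∫⁻ p in Ioo (0 : ℝ) lam ×ˢ (univ : Set ℝ),
        ENNReal.ofReal (1 / (4 * p.2 ^ 2) * (P.mux.rnDeriv P.mu p) ^ 2) ∂P.mu := by
  rw [FinftyLam, ← lintegral_add_left (by fun_prop)]
  refine lintegral_congr fun p => ?_
  rw [ENNReal.ofReal_add (by positivity) (by positivity)]

lemma tendsto_setIntegral_comp_dilate {m : Measure (ℝ × ℝ)} [IsFiniteMeasure m]
    (hm : m (Ioo (0 : ℝ) 1 ×ˢ (univ : Set ℝ))ᶜ = 0) {φ : ℝ × ℝ → ℝ} (hφ : Continuous φ)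
    (hφ' : HasCompactSupport φ) :
    Tendsto (fun c : ℝ => ∫ p in dilate c ⁻¹' (Ioo (0 : ℝ) 1 ×ˢ (univ : Set ℝ)),
      φ (dilate c p) ∂m) (𝓝 1) (𝓝 (∫ p, φ p ∂m)) := by
  obtain ⟨C, hC⟩ := hφ'.exists_bound_of_continuous hφ
  have hopen : IsOpen (Ioo (0 : ℝ) 1 ×ˢ (univ : Set ℝ)) := isOpen_Ioo.prod isOpen_univ
  have hpre : ∀ c : ℝ, MeasurableSet (dilate c ⁻¹' (Ioo (0 : ℝ) 1 ×ˢ (univ : Set ℝ))) :=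
    fun c => (hopen.preimage (continuous_dilate c)).measurableSet
  simp_rw [← integral_indicator (hpre _)]
  refine tendsto_integral_filter_of_dominated_convergence (fun _ => C) ?_ ?_
    (integrable_const C) ?_
  · exact Eventually.of_forall fun c =>
      ((hφ.comp (continuous_dilate c)).aestronglyMeasurable.indicator (hpre c))
  · exact Eventually.of_forall fun c => Eventually.of_forall fun p =>
      (norm_indicator_le_norm_self _ _).trans (hC _)
  · filter_upwards [mem_ae_iff.2 hm] with p hp
    have hlim : Tendsto (fun c : ℝ => dilate c p) (𝓝 1) (𝓝 p) := by
      have : Continuous fun c : ℝ => dilate c p := by unfold dilate; fun_prop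
      simpa [dilate] using this.tendsto 1
    refine ((hφ.tendsto p).comp hlim).congr' ?_
    filter_upwards [hlim (hopen.mem_nhds hp)] with c hcp
    rw [indicator_of_mem (show p ∈ dilate c ⁻¹' _ from hcp)]
    rfl

lemma IsDisintegrationX.dilatePair {c : NNReal} (hc : c ≠ 0) {P : MeasPair}
    {ν : ℝ → Measure ℝ} (hν : IsDisintegrationX (Ioo (0 : ℝ) 1) P.mu ν fun x => 2 * x) :
    IsDisintegrationX (Ioo (0 : ℝ) c) (dilatePair c P).mu (fun x => ν (x / c))
      fun x => 2 * x := by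
  have hc' : (0 : ℝ) < c := by positivity
  have he := measurableEmbedding_dilate hc'.ne'
  refine ⟨fun s hs => (hν.1 s hs).comp (measurable_id.div_const _), fun x hx => ?_, ?_,
    fun f hf => ?_⟩
  · exact hν.2.1 _ ⟨div_pos hx.1 hc', (div_lt_one hc').2 hx.2⟩
  · exact (ContinuousOn.integrableOn_Icc (by fun_prop)).mono_set Ioo_subset_Icc_self
  · have hf' : Integrable (f ∘ dilate c) P.mu := by
      rw [← he.integrable_map_iff]
      refine (integrable_smul_measure (c := (c ^ 2 : NNReal)) ?_ ENNReal.coe_ne_top).1 hf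
      simpa using hc
    rw [setIntegral_dilatePair hc, preimage_dilate_strip hc']
    refine (congrArg _ (hν.2.2.2 _ hf')).trans ?_
    rw [setIntegral_Ioo_comp_mul_left hc', ← integral_const_mul, ← integral_const_mul]
    congr 1 with x
    simp only [Function.comp_apply, dilate, mul_div_cancel_left₀ _ hc'.ne']
    ring

/-- **Dilation of `μ`.** For `μ ∈ M_∞` and `λ ∈ (1,2)` there is `μ_λ ∈ M_∞^λ` such that
`(μ_λ, μ_{λ,x})⌐((0,1)×ℝ) ⇀* (μ, μ_{,x})` as `λ ↓ 1`, the two energy identities hold,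
`F_∞^λ(μ_λ) → F_∞(μ)`, and `(ν_{x/λ}, 2x)_{x ∈ (0,λ)}` disintegrates `μ_λ` whenever
`(ν_x, 2x)_{x ∈ (0,1)}` disintegrates `μ`. -/
theorem dilation (P : MeasPair) (hP : MemMInfty P) :
    ∃ Q : ℝ → MeasPair,
      (∀ lam ∈ Ioo (1 : ℝ) 2, MemMInftyLam lam (Q lam)) ∧
      (∀ lam ∈ Ioo (1 : ℝ) 2,
        (∫⁻ p in Ioo (0 : ℝ) lam ×ˢ (univ : Set ℝ), ENNReal.ofReal (p.2 ^ 2) ∂(Q lam).mu) =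
          ENNReal.ofReal (lam ^ 2) *
            ∫⁻ p in Ioo (0 : ℝ) 1 ×ˢ (univ : Set ℝ), ENNReal.ofReal (p.2 ^ 2) ∂P.mu) ∧
      (∀ lam ∈ Ioo (1 : ℝ) 2,
        (∫⁻ p in Ioo (0 : ℝ) lam ×ˢ (univ : Set ℝ),
            ENNReal.ofReal (1 / (4 * p.2 ^ 2) * ((Q lam).mux.rnDeriv (Q lam).mu p) ^ 2)
              ∂(Q lam).mu) =
          ∫⁻ p in Ioo (0 : ℝ) 1 ×ˢ (univ : Set ℝ),
            ENNReal.ofReal (1 / (4 * p.2 ^ 2) * (P.mux.rnDeriv P.mu p) ^ 2) ∂P.mu) ∧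
      (∀ φ : ℝ × ℝ → ℝ, Continuous φ → HasCompactSupport φ →
        Tendsto (fun lam => ∫ p in Ioo (0 : ℝ) 1 ×ˢ (univ : Set ℝ), φ p ∂(Q lam).mu)
          (𝓝[>] (1 : ℝ)) (𝓝 (∫ p, φ p ∂P.mu)) ∧
        Tendsto (fun lam => sIntOn (Q lam).mux (Ioo (0 : ℝ) 1 ×ˢ (univ : Set ℝ)) φ)
          (𝓝[>] (1 : ℝ)) (𝓝 (sInt P.mux φ))) ∧
      Tendsto (fun lam => FinftyLam lam (Q lam)) (𝓝[>] (1 : ℝ)) (𝓝 (Finfty P)) ∧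
      (∀ ν : ℝ → Measure ℝ, IsDisintegrationX (Ioo (0 : ℝ) 1) P.mu ν (fun x => 2 * x) →
        ∀ lam ∈ Ioo (1 : ℝ) 2,
          IsDisintegrationX (Ioo (0 : ℝ) lam) (Q lam).mu (fun x => ν (x / lam))
            (fun x => 2 * x)) := by
  have := hP.1
  have hlift : ∀ lam ∈ Ioo (1 : ℝ) 2, ∃ c : NNReal, c ≠ 0 ∧ (c : ℝ) = lam := fun lam h =>
    ⟨⟨lam, by linarith [h.1]⟩, fun h0 => by
      have : lam = 0 := congrArg NNReal.toReal h0
      linarith [h.1], rfl⟩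
  have hnear : ∀ᶠ lam : ℝ in 𝓝[>] 1, lam ∈ Ioo (1 : ℝ) 2 :=
    Ioo_mem_nhdsGT (by norm_num)
  have hid : Tendsto (fun lam : ℝ => lam) (𝓝[>] 1) (𝓝 1) := nhdsWithin_le_nhds
  have hnull := hP.measure_compl_eq_zero
  have htv : P.mux.totalVariation (Ioo (0 : ℝ) 1 ×ˢ (univ : Set ℝ))ᶜ = 0 := hP.2.2.2.2.1 hnull
  rw [SignedMeasure.totalVariation, Measure.add_apply, add_eq_zero] at htv
  refine ⟨fun lam => dilatePair lam.toNNReal P, fun lam h => ?_, fun lam h => ?_, fun lam h => ?_,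
    fun φ hφ hφ' => ⟨?_, ?_⟩, ?_, fun ν hν lam h => ?_⟩
  · obtain ⟨c, hc, rfl⟩ := hlift lam h
    simpa using memMInftyLam_dilatePair hc hP
  · obtain ⟨c, hc, rfl⟩ := hlift lam h
    simpa [ENNReal.ofReal_pow] using lintegral_sq_dilatePair hc P
  · obtain ⟨c, hc, rfl⟩ := hlift lam h
    simp only [Real.toNNReal_coe]
    exact lintegral_rnDeriv_sq_dilatePair hc P
  · have hlim := (hid.pow 2).mul ((tendsto_setIntegral_comp_dilate hnull hφ hφ').comp hid)
    rw [one_pow, one_mul] at hlim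
    refine hlim.congr' ?_
    filter_upwards [hnear] with lam h
    obtain ⟨c, hc, rfl⟩ := hlift lam h
    rw [Real.toNNReal_coe]
    exact (setIntegral_dilatePair hc P _ φ).symm
  · have hlim := hid.mul (((tendsto_setIntegral_comp_dilate htv.1 hφ hφ').sub
      (tendsto_setIntegral_comp_dilate htv.2 hφ hφ')).comp hid)
    rw [one_mul] at hlim
    refine hlim.congr' ?_
    filter_upwards [hnear] with lam h
    obtain ⟨c, hc, rfl⟩ := hlift lam h
    rw [Real.toNNReal_coe]
    exact (sIntOn_dilatePair hc P _ φ).symm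
  · have hsq : Tendsto (fun lam : ℝ => ENNReal.ofReal (lam ^ 2)) (𝓝[>] 1) (𝓝 1) := by
      simpa using ENNReal.tendsto_ofReal (hid.pow 2)
    have hlim := (ENNReal.Tendsto.mul_const
      (b := ∫⁻ p in Ioo (0 : ℝ) 1 ×ˢ (univ : Set ℝ), ENNReal.ofReal (p.2 ^ 2) ∂P.mu) hsq
      (Or.inl one_ne_zero)).add_const
      (∫⁻ p in Ioo (0 : ℝ) 1 ×ˢ (univ : Set ℝ),
        ENNReal.ofReal (1 / (4 * p.2 ^ 2) * (P.mux.rnDeriv P.mu p) ^ 2) ∂P.mu)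
    rw [one_mul, ← FinftyLam_eq_add] at hlim
    refine hlim.congr' ?_
    filter_upwards [hnear] with lam h
    obtain ⟨c, hc, rfl⟩ := hlift lam h
    rw [Real.toNNReal_coe, FinftyLam_eq_add, lintegral_sq_dilatePair hc,
      lintegral_rnDeriv_sq_dilatePair hc]
    simp [ENNReal.ofReal_pow]
  · obtain ⟨c, hc, rfl⟩ := hlift lam h
    simpa using hν.dilatePair hc
end
end
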